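/- Let ξ ∈ h*/ℤR have zero central charge, let λ ∈ ξ and i ∈ ℤ≥0. Then in the truncated category O[ξ,λ] the simple module L(λ - i h✓) is a quotient of a unique (up to isomorphism) indecomposable projective object P^{(λ)}(λ - i h✓); moreover there is a surjection P^{(λ)}(λ - i h✓) ↠ Δ(λ - i h✓) whose kernel has a filtration with subquotients Verma modules, and the only Verma modules occurring as subquotients of such a filtration are Δ(λ - j h✓) with j < i. -/

import Mathlib

set_option maxSynthPendingDepth 3

namespace Schrodinger

noncomputable section

open scoped TensorProduct

/-- Generators of the Schrödinger algebra. -/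
inductive Gen : Type
  | E | H | F | P | Q | Z
  deriving DecidableEq

/-- The free algebra on the generators. -/
abbrev FA : Type := FreeAlgebra ℂ Gen

/-- Inclusion of generators. -/
def ιg (g : Gen) : FA := FreeAlgebra.ι ℂ g

/-- The defining relations of the universal enveloping algebra of the Schrödinger
algebra `s`: `z` is central and `[h,e]=2e`, `[e,f]=h`, `[h,f]=-2f`, `[e,q]=p`,
`[e,p]=0`, `[h,p]=p`, `[f,p]=q`, `[f,q]=0`, `[h,q]=-q`, `[p,q]=z`. -/
inductive Rel : FA → FA → Prop
  | he : Rel (ιg .H * ιg .E) (ιg .E * ιg .H + 2 * ιg .E)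
  | ef : Rel (ιg .E * ιg .F) (ιg .F * ιg .E + ιg .H)
  | hf : Rel (ιg .H * ιg .F) (ιg .F * ιg .H - 2 * ιg .F)
  | eq : Rel (ιg .E * ιg .Q) (ιg .Q * ιg .E + ιg .P)
  | ep : Rel (ιg .E * ιg .P) (ιg .P * ιg .E)
  | hp : Rel (ιg .H * ιg .P) (ιg .P * ιg .H + ιg .P)
  | fp : Rel (ιg .F * ιg .P) (ιg .P * ιg .F + ιg .Q)
  | fq : Rel (ιg .F * ιg .Q) (ιg .Q * ιg .F)
  | hq : Rel (ιg .H * ιg .Q) (ιg .Q * ιg .H - ιg .Q)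
  | pq : Rel (ιg .P * ιg .Q) (ιg .Q * ιg .P + ιg .Z)
  | ze : Rel (ιg .Z * ιg .E) (ιg .E * ιg .Z)
  | zh : Rel (ιg .Z * ιg .H) (ιg .H * ιg .Z)
  | zf : Rel (ιg .Z * ιg .F) (ιg .F * ιg .Z)
  | zp : Rel (ιg .Z * ιg .P) (ιg .P * ιg .Z)
  | zq : Rel (ιg .Z * ιg .Q) (ιg .Q * ιg .Z)

/-- The universal enveloping algebra `U = U(s)` of the Schrödinger algebra,
presented by generators and relations (via the PBW theorem). -/
abbrev U : Type := RingQuot Rel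

/-- The generators of `U`. -/
def gen (g : Gen) : U := RingQuot.mkAlgHom ℂ Rel (ιg g)

def E : U := gen .E
def H : U := gen .H
def F : U := gen .F
def P : U := gen .P
def Q : U := gen .Q
def Z : U := gen .Z

/-- Scalars inside `U`. -/
def sc (a : ℂ) : U := algebraMap ℂ U a

/-- The Casimir element `c = (h² + h + 4fe)z − 2(fp² − eq² − hpq)`. -/
def cElt : U := (H * H + H + 4 * (F * E)) * Z - 2 * (F * (P * P) - E * (Q * Q) - H * (P * Q))

/-- The left ideal of `U` defining the Verma module `Δ(λ)` for
`λ ∈ 𝔥*` with `λ(h) = hh`, `λ(z) = zz`:  it is generated by `n₊ = span{e,p}`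
together with `h - λ(h)` and `z - λ(z)`; then
`Δ(λ) = U ⊗_{U(𝔟)} ℂ_λ ≅ U / U(e, p, h - λ(h), z - λ(z))`. -/
def vermaIdeal (hh zz : ℂ) : Submodule U U :=
  Submodule.span U ({E, P, H - sc hh, Z - sc zz} : Set U)

/-- The Verma module `Δ(λ)` with highest weight `λ`, `λ(h) = hh`, `λ(z) = zz`. -/
abbrev Verma (hh zz : ℂ) : Type := U ⧸ vermaIdeal hh zz

/-- The canonical highest weight generator `v_λ` of `Δ(λ)`. -/
def hwVec (hh zz : ℂ) : Verma hh zz := Submodule.Quotient.mk 1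

/-- The unique maximal submodule `K(λ)` of `Δ(λ)`. -/
def vermaRad (hh zz : ℂ) : Submodule U (Verma hh zz) := sSup {N : Submodule U (Verma hh zz) | N ≠ ⊤}

/-- The simple highest weight module `L(λ) = Δ(λ)/K(λ)`. -/
abbrev SimpleHW (hh zz : ℂ) : Type := Verma hh zz ⧸ vermaRad hh zz

/-- The scalar `ϑ_λ = (λ(h)² + 3λ(h) + 2)·λ(z)` by which the Casimir element `c`
acts on the Verma module `Δ(λ)`. -/
def vartheta (hh zz : ℂ) : ℂ := (hh ^ 2 + 3 * hh + 2) * zz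

end

end Schrodinger

namespace Schrodinger

noncomputable section

open CategoryTheory

/-- The `ℂ`-vector space structure on a `U`-module, obtained by restricting
scalars along `ℂ → U`. -/
def cmod (M : Type) [AddCommGroup M] [Module U M] : Module ℂ M :=
  Module.compHom M (algebraMap ℂ U)

/-- `v` is a weight vector of weight `λ` with `λ(h) = hh` and `λ(z) = zz`. -/
def IsWeightVec {M : Type} [AddCommGroup M] [Module U M] (hh zz : ℂ) (v : M) : Prop :=
  H • v = sc hh • v ∧ Z • v = sc zz • v

/-- The subalgebra `U(n₊)` of `U` generated by `n₊ = span{e, p}`. -/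
def nPlus : Subalgebra ℂ U := Algebra.adjoin ℂ ({E, P} : Set U)

/-- Membership in category `O`: finitely generated, a (direct) sum of its
weight spaces, and locally `U(n₊)`-finite. -/
def InO (M : Type) [AddCommGroup M] [Module U M] : Prop :=
  Module.Finite U M ∧
  (∀ v : M, v ∈ AddSubgroup.closure {w : M | ∃ hh zz : ℂ, IsWeightVec hh zz w}) ∧
  (letI := cmod M
   ∀ v : M, ∃ W : Submodule ℂ M, FiniteDimensional ℂ W ∧ ∀ u ∈ nPlus, u • v ∈ W)

/-- Membership in the block `O[ξ]`, where `ξ ∈ 𝔥*/ℤR` is the class of the weight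
`(hh0, zz0)` (so that the weights in `ξ` are exactly `(hh0 + n, zz0)`, `n ∈ ℤ`):
the module is in `O` and all its weights lie in `ξ`. -/
def InBlock (hh0 zz0 : ℂ) (M : ModuleCat.{0} U) : Prop :=
  InO M ∧
  ∀ (v : M) (hh zz : ℂ), v ≠ 0 → IsWeightVec hh zz v → zz = zz0 ∧ ∃ n : ℤ, hh = hh0 + n

/-- The Verma module as an object of the category of `U`-modules. -/
def VermaC (hh zz : ℂ) : ModuleCat.{0} U := ModuleCat.of U (Verma hh zz)

/-- `Pc` is a Serre class inside the subcategory (of the category of `U`-modules)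
cut out by `Oc`: it is contained in `Oc`, closed under isomorphism, and for every
short exact sequence `0 → N → M → M/N → 0` in `Oc`, `M` belongs to `Pc` if and only
if both `N` and `M/N` do. -/
def SerreClassIn (Oc Pc : ModuleCat.{0} U → Prop) : Prop :=
  (∀ M, Pc M → Oc M) ∧
  (∀ M N : ModuleCat.{0} U, Nonempty ((M : Type) ≃ₗ[U] (N : Type)) → Pc M → Oc N → Pc N) ∧
  (∀ (M : ModuleCat.{0} U) (N : Submodule U M), Oc M →
      (Pc M ↔ Pc (ModuleCat.of U N) ∧ Pc (ModuleCat.of U ((M : Type) ⧸ N))))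

/-- Membership in the Serre subcategory of the subcategory cut out by `Oc`
generated by the set of objects `S`. -/
def InSerreGen (Oc : ModuleCat.{0} U → Prop) (S : Set (ModuleCat.{0} U))
    (M : ModuleCat.{0} U) : Prop :=
  Oc M ∧ ∀ Pc : ModuleCat.{0} U → Prop, SerreClassIn Oc Pc → (∀ X ∈ S, Pc X) → Pc M

end

end Schrodinger

namespace Schrodinger

open CategoryTheory

noncomputable section

/-- Membership in the truncated category `O[ξ, λ]`, where `ξ` is the (zero
central charge) block of the weight `λ` with `λ(h) = hh0`, `λ(z) = 0`: the
objects are the modules `M` of `O[ξ]` with `M_{λ + i·h✓} = 0` for all `i ≥ 1`. -/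
def InTrunc (hh0 : ℂ) (M : ModuleCat.{0} U) : Prop :=
  InBlock hh0 0 M ∧
  ∀ (v : M) (i : ℕ), 1 ≤ i → IsWeightVec (hh0 + i) 0 v → v = 0

/-- `Pm` is a projective object of the truncated category `O[ξ, λ]`. -/
def ProjInTrunc (hh0 : ℂ) (Pm : ModuleCat.{0} U) : Prop :=
  ∀ M N : ModuleCat.{0} U, InTrunc hh0 M → InTrunc hh0 N →
    ∀ g : (M : Type) →ₗ[U] N, Function.Surjective g →
      ∀ f : (Pm : Type) →ₗ[U] N, ∃ f' : (Pm : Type) →ₗ[U] M, g ∘ₗ f' = f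

/-- `Pm` is an indecomposable module. -/
def Indec (Pm : ModuleCat.{0} U) : Prop :=
  Nontrivial Pm ∧
  ¬ ∃ N₁ N₂ : Submodule U Pm, IsCompl N₁ N₂ ∧ N₁ ≠ ⊥ ∧ N₂ ≠ ⊥

/-- The subquotient `B/A` associated to submodules `A ≤ B` of a module. -/
def subQuot {M : Type} [AddCommGroup M] [Module U M] (A B : Submodule U M) : Type :=
  B ⧸ Submodule.comap B.subtype A

noncomputable instance {M : Type} [AddCommGroup M] [Module U M] (A B : Submodule U M) :
    AddCommGroup (subQuot A B) := by unfold subQuot; infer_instance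

noncomputable instance {M : Type} [AddCommGroup M] [Module U M] (A B : Submodule U M) :
    Module U (subQuot A B) := by unfold subQuot; infer_instance

/-- `K` has a filtration by submodules whose subquotients are Verma modules
`Δ(λ - j·h✓)` with `j < i` (zero central charge, `λ(h) = hh0`). -/
def HasVermaFlagBelow (hh0 : ℂ) (i : ℕ) {M : ModuleCat.{0} U}
    (K : Submodule U M) : Prop :=
  ∃ (n : ℕ) (Fl : Fin (n + 1) → Submodule U (M : Type)),
    Monotone Fl ∧ Fl 0 = ⊥ ∧ Fl (Fin.last n) = K ∧
    ∀ k : Fin n, ∃ j : ℕ, j < i ∧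
      Nonempty (subQuot (Fl k.castSucc) (Fl k.succ) ≃ₗ[U] Verma (hh0 - j) 0)

/-! ### Working with `U`-modules through generators -/

theorem U_induction {p : U → Prop} (hsc : ∀ a : ℂ, p (algebraMap ℂ U a)) (hgen : ∀ g, p (gen g))
    (hmul : ∀ x y, p x → p y → p (x * y)) (hadd : ∀ x y, p x → p y → p (x + y)) (u : U) : p u := by
  obtain ⟨x, rfl⟩ := RingQuot.mkAlgHom_surjective ℂ Rel u
  induction x using FreeAlgebra.induction with
  | grade0 r => simpa using hsc r
  | grade1 g => exact hgen g
  | mul a b ha hb => simpa using hmul _ _ ha hb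
  | add a b ha hb => simpa using hadd _ _ ha hb

/-- A defining relation of `U`, read in `U`. -/
theorem mk_rel {x y : FA} (h : Rel x y) :
    RingQuot.mkAlgHom ℂ Rel x = RingQuot.mkAlgHom ℂ Rel y :=
  RingQuot.mkAlgHom_rel ℂ h

theorem mk_two : RingQuot.mkAlgHom ℂ Rel 2 = 2 := map_ofNat _ 2

theorem H_mul_E : H * E = E * H + 2 * E := by simpa [H, E, gen, mk_two] using mk_rel Rel.he
theorem E_mul_F : E * F = F * E + H := by simpa [H, E, F, gen] using mk_rel Rel.ef
theorem H_mul_F : H * F = F * H - 2 * F := by simpa [H, F, gen, mk_two] using mk_rel Rel.hf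
theorem E_mul_Q : E * Q = Q * E + P := by simpa [P, E, Q, gen] using mk_rel Rel.eq
theorem E_mul_P : E * P = P * E := by simpa [P, E, gen] using mk_rel Rel.ep
theorem H_mul_P : H * P = P * H + P := by simpa [P, H, gen] using mk_rel Rel.hp
theorem F_mul_P : F * P = P * F + Q := by simpa [P, F, Q, gen] using mk_rel Rel.fp
theorem F_mul_Q : F * Q = Q * F := by simpa [F, Q, gen] using mk_rel Rel.fq
theorem H_mul_Q : H * Q = Q * H - Q := by simpa [H, Q, gen] using mk_rel Rel.hq
theorem P_mul_Q : P * Q = Q * P + Z := by simpa [P, Q, Z, gen] using mk_rel Rel.pq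
theorem Z_mul_gen (g : Gen) : Z * gen g = gen g * Z := by
  cases g
  · simpa [Z, gen] using mk_rel Rel.ze
  · simpa [Z, gen] using mk_rel Rel.zh
  · simpa [Z, gen] using mk_rel Rel.zf
  · simpa [Z, gen] using mk_rel Rel.zp
  · simpa [Z, gen] using mk_rel Rel.zq
  · rfl

section Modules

variable {M : Type} [AddCommGroup M] [Module U M] [Module ℂ M] [IsScalarTower ℂ U M]
variable {M' : Type} [AddCommGroup M'] [Module U M'] [Module ℂ M'] [IsScalarTower ℂ U M']

theorem sc_smul (a : ℂ) (v : M) : sc a • v = a • v := algebraMap_smul U a v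

theorem smul_comm_U (u : U) (a : ℂ) (v : M) : u • a • v = a • u • v := smul_comm u a v

theorem smul_mem_of_gen (W : Submodule ℂ M) (h : ∀ g, ∀ w ∈ W, gen g • w ∈ W) (u : U) :
    ∀ w ∈ W, u • w ∈ W := by
  induction u using U_induction with
  | hsc a => intro w hw; rw [algebraMap_smul]; exact W.smul_mem a hw
  | hgen g => exact h g
  | hmul x y hx hy => intro w hw; rw [mul_smul]; exact hx _ (hy _ hw)
  | hadd x y hx hy => intro w hw; rw [add_smul]; exact W.add_mem (hx _ hw) (hy _ hw)

/-- A `ℂ`-subspace stable under the generators, as a `U`-submodule. -/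
def submoduleOfGen (W : Submodule ℂ M) (h : ∀ g, ∀ w ∈ W, gen g • w ∈ W) : Submodule U M where
  carrier := W
  add_mem' := W.add_mem
  zero_mem' := W.zero_mem
  smul_mem' u w := smul_mem_of_gen W h u w

/-- A `ℂ`-linear map commuting with the generators, as a `U`-linear map. -/
def linearMapOfGen (T : M →ₗ[ℂ] M') (h : ∀ g w, T (gen g • w) = gen g • T w) : M →ₗ[U] M' where
  toFun := T
  map_add' := T.map_add
  map_smul' u := by
    simp only [RingHom.id_apply]
    induction u using U_induction with
    | hsc a => intro w; rw [algebraMap_smul, algebraMap_smul, T.map_smul]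
    | hgen g => exact h g
    | hmul x y hx hy => intro w; rw [mul_smul, mul_smul, hx, hy]
    | hadd x y hx hy => intro w; rw [add_smul, add_smul, T.map_add, hx, hy]

theorem linearMapOfGen_apply {T : M →ₗ[ℂ] M'} {h : ∀ g w, T (gen g • w) = gen g • T w} (w : M) :
    linearMapOfGen T h w = T w := rfl

variable (M) in
/-- The eigenspace of `h` for the eigenvalue `ν`. -/
def wt (ν : ℂ) : Submodule ℂ M := Module.End.eigenspace (Algebra.lsmul ℂ ℂ M H) ν

theorem mem_wt {ν : ℂ} {v : M} : v ∈ wt M ν ↔ H • v = ν • v := by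
  rw [wt, Module.End.mem_eigenspace_iff]; rfl

theorem isWeightVec_iff {hh zz : ℂ} {v : M} :
    IsWeightVec hh zz v ↔ v ∈ wt M hh ∧ Z • v = zz • v := by
  rw [IsWeightVec, mem_wt, sc_smul, sc_smul]

variable (M) in
theorem disjoint_wt (ν : ℂ) : Disjoint (wt M ν) (⨆ κ ≠ ν, wt M κ) :=
  Module.End.eigenspaces_iSupIndep (Algebra.lsmul ℂ ℂ M H) ν

theorem map_mem_wt (f : M →ₗ[U] M') {ν : ℂ} {v : M} (hv : v ∈ wt M ν) : f v ∈ wt M' ν := by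
  rw [mem_wt] at *
  rw [← f.map_smul, hv, LinearMap.map_smul_of_tower]

theorem map_mem_iSup_wt (f : M →ₗ[U] M') {ν : ℂ} {v : M} (hv : v ∈ ⨆ κ ≠ ν, wt M κ) :
    f v ∈ ⨆ κ ≠ ν, wt M' κ := by
  have : (⨆ κ ≠ ν, wt M κ) ≤ (⨆ κ ≠ ν, wt M' κ).comap (f.restrictScalars ℂ) :=
    iSup₂_le fun κ hκ w hw => Submodule.mem_iSup_of_mem κ
      (Submodule.mem_iSup_of_mem hκ (map_mem_wt f hw))
  exact this hv

theorem exists_wt_add {ν : ℂ} (hM : ⨆ κ, wt M κ = ⊤) (v : M) :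
    ∃ a ∈ wt M ν, ∃ b ∈ ⨆ κ ≠ ν, wt M κ, v = a + b := by
  have : (⊤ : Submodule ℂ M) ≤ wt M ν ⊔ ⨆ κ ≠ ν, wt M κ := by
    rw [← hM]
    refine iSup_le fun κ => ?_
    by_cases h : κ = ν
    · exact h ▸ le_sup_left
    · exact le_sup_of_le_right (le_iSup₂_of_le κ h le_rfl)
  obtain ⟨a, ha, b, hb, h⟩ := Submodule.mem_sup.1 (this (Submodule.mem_top (x := v)))
  exact ⟨a, ha, b, hb, h.symm⟩

/-- Weight vectors lift along surjections. -/
theorem exists_lift_wt {ν : ℂ} (hM : ⨆ κ, wt M κ = ⊤) (f : M →ₗ[U] M')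
    (hf : Function.Surjective f) {w : M'} (hw : w ∈ wt M' ν) : ∃ v ∈ wt M ν, f v = w := by
  obtain ⟨m, rfl⟩ := hf w
  obtain ⟨a, ha, b, hb, rfl⟩ := exists_wt_add (ν := ν) hM m
  refine ⟨a, ha, ?_⟩
  have h1 : f b ∈ wt M' ν := by
    have := Submodule.sub_mem _ hw (map_mem_wt f ha)
    rwa [map_add, add_sub_cancel_left] at this
  rw [map_add, Submodule.disjoint_def.1 (disjoint_wt M' ν) _ h1 (map_mem_iSup_wt f hb), add_zero]

theorem map_wt_top (hM : ⨆ κ, wt M κ = ⊤) (f : M →ₗ[U] M') (hf : Function.Surjective f) :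
    ⨆ κ, wt M' κ = ⊤ := by
  have : (⨆ κ, wt M κ) ≤ (⨆ κ, wt M' κ).comap (f.restrictScalars ℂ) :=
    iSup_le fun κ w hw => Submodule.mem_iSup_of_mem κ (map_mem_wt f hw)
  rw [hM] at this
  refine eq_top_iff.2 fun w _ => ?_
  obtain ⟨m, rfl⟩ := hf w
  exact this Submodule.mem_top

theorem E_smul_mem_wt {ν : ℂ} {v : M} (hv : v ∈ wt M ν) : E • v ∈ wt M (ν + 2) := by
  rw [mem_wt] at *
  rw [← mul_smul, H_mul_E, add_smul, mul_smul, hv, smul_comm_U, mul_smul, add_smul]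
  congr 1
  rw [two_smul, two_smul]

theorem P_smul_mem_wt {ν : ℂ} {v : M} (hv : v ∈ wt M ν) : P • v ∈ wt M (ν + 1) := by
  rw [mem_wt] at *
  rw [← mul_smul, H_mul_P, add_smul, mul_smul, hv, smul_comm_U, add_smul, one_smul]

theorem F_smul_mem_wt {ν : ℂ} {v : M} (hv : v ∈ wt M ν) : F • v ∈ wt M (ν - 2) := by
  rw [mem_wt] at *
  rw [← mul_smul, H_mul_F, sub_smul, mul_smul, hv, smul_comm_U, mul_smul, sub_smul]
  congr 1
  rw [two_smul, two_smul]

theorem Q_smul_mem_wt {ν : ℂ} {v : M} (hv : v ∈ wt M ν) : Q • v ∈ wt M (ν - 1) := by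
  rw [mem_wt] at *
  rw [← mul_smul, H_mul_Q, sub_smul, mul_smul, hv, smul_comm_U, sub_smul, one_smul]

theorem EP_smul_mem_wt {ν : ℂ} {v : M} (hv : v ∈ wt M ν) (c d : ℕ) :
    (E ^ c * P ^ d) • v ∈ wt M (ν + (2 * c + d : ℕ)) := by
  induction c with
  | zero =>
    induction d with
    | zero => simpa using hv
    | succ d ih =>
      simp only [pow_zero, one_mul] at *
      rw [pow_succ', mul_smul]
      convert P_smul_mem_wt ih using 2
      push_cast; ring
  | succ c ih =>
    rw [pow_succ', mul_assoc, mul_smul]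
    convert E_smul_mem_wt ih using 2
    push_cast; ring

theorem FQ_smul_mem_wt {ν : ℂ} {v : M} (hv : v ∈ wt M ν) (a b : ℕ) :
    (F ^ a * Q ^ b) • v ∈ wt M (ν - (2 * a + b : ℕ)) := by
  induction a with
  | zero =>
    induction b with
    | zero => simpa using hv
    | succ d ih =>
      simp only [pow_zero, one_mul] at *
      rw [pow_succ', mul_smul]
      convert Q_smul_mem_wt ih using 2
      push_cast; ring
  | succ c ih =>
    rw [pow_succ', mul_assoc, mul_smul]
    convert F_smul_mem_wt ih using 2
    push_cast; ring

end Modules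
/-! ### Modules induced from `𝔟` with `z` acting by zero -/

section Induction

variable {N : Type} [AddCommGroup N] [Module ℂ N]

/-- The vector `f ^ a * q ^ b ⊗ n` of the induced module. -/
abbrev mono (a b : ℕ) : N →ₗ[ℂ] (ℕ × ℕ →₀ N) := Finsupp.lsingle (a, b)

variable (N) in
/-- The action of `f` on the induced module. -/
def opF : Module.End ℂ (ℕ × ℕ →₀ N) := Finsupp.lsum ℂ fun x => mono (x.1 + 1) x.2

variable (N) in
/-- The action of `q` on the induced module. -/
def opQ : Module.End ℂ (ℕ × ℕ →₀ N) := Finsupp.lsum ℂ fun x => mono x.1 (x.2 + 1)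

/-- The action of `h` on the induced module. -/
def opH (D : Module.End ℂ N) : Module.End ℂ (ℕ × ℕ →₀ N) :=
  Finsupp.lsum ℂ fun x => mono x.1 x.2 ∘ₗ (D - (2 * x.1 + x.2 : ℂ) • 1)

/-- The action of `p` on the induced module. -/
def opP (Y : Module.End ℂ N) : Module.End ℂ (ℕ × ℕ →₀ N) :=
  Finsupp.lsum ℂ fun x => mono x.1 x.2 ∘ₗ Y - (x.1 : ℂ) • mono (x.1 - 1) (x.2 + 1)

/-- The action of `e` on the induced module. -/
def opE (D X Y : Module.End ℂ N) : Module.End ℂ (ℕ × ℕ →₀ N) :=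
  Finsupp.lsum ℂ fun x => mono x.1 x.2 ∘ₗ X + (x.2 : ℂ) • (mono x.1 (x.2 - 1) ∘ₗ Y) +
    (x.1 : ℂ) • (mono (x.1 - 1) x.2 ∘ₗ (D - (x.2 + x.1 - 1 : ℂ) • 1))

variable (D X Y : Module.End ℂ N) (a b : ℕ) (n : N)

theorem opF_mono : opF N (mono a b n) = mono (a + 1) b n := by simp [opF]

theorem opQ_mono : opQ N (mono a b n) = mono a (b + 1) n := by simp [opQ]

theorem opH_mono : opH D (mono a b n) = mono a b (D n) - (2 * a + b : ℂ) • mono a b n := by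
  simp only [opH, Finsupp.lsum_apply, mono, Finsupp.lsingle_apply]
  rw [Finsupp.sum_single_index (by simp)]
  simp

theorem opP_mono : opP Y (mono a b n) = mono a b (Y n) - (a : ℂ) • mono (a - 1) (b + 1) n := by
  simp only [opP, Finsupp.lsum_apply, mono, Finsupp.lsingle_apply]
  rw [Finsupp.sum_single_index (by simp)]
  simp

theorem opE_mono : opE D X Y (mono a b n) = mono a b (X n) + (b : ℂ) • mono a (b - 1) (Y n) +
    (a : ℂ) • (mono (a - 1) b (D n) - (b + a - 1 : ℂ) • mono (a - 1) b n) := by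
  simp only [opE, Finsupp.lsum_apply, mono, Finsupp.lsingle_apply]
  rw [Finsupp.sum_single_index (by simp)]
  simp

theorem end_ext {S T : Module.End ℂ (ℕ × ℕ →₀ N)}
    (h : ∀ a b n, S (mono a b n) = T (mono a b n)) : S = T :=
  Finsupp.lhom_ext fun x n => h x.1 x.2 n

variable {D X Y}

theorem opH_mul_opE (hX : ∀ n, D (X n) = X (D n) + (2 : ℂ) • X n)
    (hY : ∀ n, D (Y n) = Y (D n) + Y n) :
    opH D * opE D X Y = opE D X Y * opH D + 2 * opE D X Y := by
  refine end_ext fun a b n => ?_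
  rw [two_mul]
  rcases a with _ | a <;> rcases b with _ | b <;>
  · simp only [Module.End.mul_apply, LinearMap.add_apply, opE_mono, opH_mono, map_add, map_sub,
      map_smul, hX, hY, Nat.add_sub_cancel, Nat.cast_add, Nat.cast_one, Nat.cast_zero, zero_smul, map_zero]
    module

theorem opE_mul_opF : opE D X Y * opF N = opF N * opE D X Y + opH D := by
  refine end_ext fun a b n => ?_
  rcases a with _ | a <;>
  · simp only [Module.End.mul_apply, LinearMap.add_apply, opE_mono, opH_mono, opF_mono, map_add,
      map_sub, map_smul, Nat.add_sub_cancel, Nat.cast_add, Nat.cast_one, Nat.cast_zero, zero_smul, map_zero,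
      zero_add]
    module

theorem opH_mul_opF : opH D * opF N = opF N * opH D - 2 * opF N := by
  refine end_ext fun a b n => ?_
  rw [two_mul]
  simp only [Module.End.mul_apply, LinearMap.add_apply, LinearMap.sub_apply, opH_mono, opF_mono,
    map_sub, map_smul, Nat.cast_add, Nat.cast_one]
  module

theorem opE_mul_opQ : opE D X Y * opQ N = opQ N * opE D X Y + opP Y := by
  refine end_ext fun a b n => ?_
  rcases a with _ | a <;> rcases b with _ | b <;>
  · simp only [Module.End.mul_apply, LinearMap.add_apply, opE_mono, opQ_mono, opP_mono, map_add,
      map_sub, map_smul, Nat.add_sub_cancel, Nat.cast_add, Nat.cast_one, Nat.cast_zero, zero_smul, map_zero,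
      zero_add]
    module

theorem opE_mul_opP (hY : ∀ n, D (Y n) = Y (D n) + Y n) (hXY : ∀ n, X (Y n) = Y (X n)) :
    opE D X Y * opP Y = opP Y * opE D X Y := by
  refine end_ext fun a b n => ?_
  rcases a with _ | _ | a <;> rcases b with _ | b <;>
  · simp only [Module.End.mul_apply, opE_mono, opP_mono, map_add,
      map_sub, map_smul, Nat.add_sub_cancel, Nat.cast_add, Nat.cast_one, Nat.cast_zero, zero_smul, map_zero,
      zero_add, hXY, hY, Nat.sub_self, one_smul]
    module

theorem opH_mul_opP (hY : ∀ n, D (Y n) = Y (D n) + Y n) :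
    opH D * opP Y = opP Y * opH D + opP Y := by
  refine end_ext fun a b n => ?_
  rcases a with _ | a <;>
  · simp only [Module.End.mul_apply, LinearMap.add_apply, opH_mono, opP_mono, map_add, map_sub,
      map_smul, hY, Nat.add_sub_cancel, Nat.cast_add, Nat.cast_one, Nat.cast_zero, zero_smul, map_zero]
    module

theorem opF_mul_opP : opF N * opP Y = opP Y * opF N + opQ N := by
  refine end_ext fun a b n => ?_
  rcases a with _ | a <;>
  · simp only [Module.End.mul_apply, LinearMap.add_apply, opF_mono, opP_mono, opQ_mono, map_sub,
      map_smul, Nat.add_sub_cancel, Nat.cast_add, Nat.cast_one, Nat.cast_zero, zero_smul, map_zero, zero_add]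
    module

theorem opF_mul_opQ : opF N * opQ N = opQ N * opF N := by
  refine end_ext fun a b n => ?_
  simp only [Module.End.mul_apply, opF_mono, opQ_mono]

theorem opH_mul_opQ : opH D * opQ N = opQ N * opH D - opQ N := by
  refine end_ext fun a b n => ?_
  simp only [Module.End.mul_apply, LinearMap.sub_apply, opH_mono, opQ_mono,
    map_sub, map_smul, Nat.cast_add, Nat.cast_one]
  module

theorem opP_mul_opQ : opP Y * opQ N = opQ N * opP Y := by
  refine end_ext fun a b n => ?_
  simp only [Module.End.mul_apply, opP_mono, opQ_mono, map_sub, map_smul]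

end Induction

/-! ### The truncated universal modules -/

/-- Exponents of the monomials `e ^ c * p ^ d` of `h`-weight at most `i`. -/
abbrev Idx (i : ℕ) : Type := {x : ℕ × ℕ // 2 * x.1 + x.2 ≤ i}

instance (i : ℕ) : Finite (Idx i) :=
  Set.Finite.to_subtype (((Set.finite_Iic i).prod (Set.finite_Iic i)).subset fun x hx => by
    have : 2 * x.1 + x.2 ≤ i := hx
    exact ⟨by simp only [Set.mem_Iic]; omega, by simp only [Set.mem_Iic]; omega⟩)

/-- The action of `h` on the truncation of `U(n₊)`. -/
def baseH (μ : ℂ) (i : ℕ) : Module.End ℂ (Idx i → ℂ) where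
  toFun n x := (μ + (2 * x.1.1 + x.1.2 : ℕ)) * n x
  map_add' _ _ := by ext; simp [mul_add]
  map_smul' _ _ := by ext; simp; ring

/-- The action of `e` on the truncation of `U(n₊)`. -/
def baseE (i : ℕ) : Module.End ℂ (Idx i → ℂ) where
  toFun n
    | ⟨(0, _), _⟩ => 0
    | ⟨(c + 1, d), h⟩ => n ⟨(c, d), by simp only at *; omega⟩
  map_add' _ _ := by ext ⟨⟨_ | _, _⟩, _⟩ <;> simp
  map_smul' _ _ := by ext ⟨⟨_ | _, _⟩, _⟩ <;> simp

/-- The action of `p` on the truncation of `U(n₊)`. -/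
def baseP (i : ℕ) : Module.End ℂ (Idx i → ℂ) where
  toFun n
    | ⟨(_, 0), _⟩ => 0
    | ⟨(c, d + 1), h⟩ => n ⟨(c, d), by simp only at *; omega⟩
  map_add' _ _ := by ext ⟨⟨_, _ | _⟩, _⟩ <;> simp
  map_smul' _ _ := by ext ⟨⟨_, _ | _⟩, _⟩ <;> simp

theorem baseH_baseE (μ : ℂ) (i : ℕ) (n : Idx i → ℂ) :
    baseH μ i (baseE i n) = baseE i (baseH μ i n) + (2 : ℂ) • baseE i n := by
  ext ⟨⟨_ | _, _⟩, _⟩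
  · simp [baseH, baseE]
  · simp [baseH, baseE]; ring

theorem baseH_baseP (μ : ℂ) (i : ℕ) (n : Idx i → ℂ) :
    baseH μ i (baseP i n) = baseP i (baseH μ i n) + baseP i n := by
  ext ⟨⟨_, _ | _⟩, _⟩
  · simp [baseH, baseP]
  · simp [baseH, baseP]; ring

theorem baseE_baseP (i : ℕ) (n : Idx i → ℂ) :
    baseE i (baseP i n) = baseP i (baseE i n) := by
  ext ⟨⟨_ | _, _ | _⟩, _⟩ <;> simp [baseE, baseP]

/-- The carrier of the universal module generated by a vector of weight `μ`, killed by `z` and by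
all elements of `U(n₊)` of weight larger than `i`. -/
def Univ (_μ : ℂ) (i : ℕ) : Type := ℕ × ℕ →₀ (Idx i → ℂ)

section

variable (μ : ℂ) (i : ℕ)

instance : AddCommGroup (Univ μ i) := inferInstanceAs (AddCommGroup (ℕ × ℕ →₀ (Idx i → ℂ)))

instance : Module ℂ (Univ μ i) := inferInstanceAs (Module ℂ (ℕ × ℕ →₀ (Idx i → ℂ)))

/-- The action of the generators of `U`. -/
def act : Gen → Module.End ℂ (ℕ × ℕ →₀ (Idx i → ℂ))
  | .E => opE (baseH μ i) (baseE i) (baseP i)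
  | .H => opH (baseH μ i)
  | .F => opF _
  | .P => opP (baseP i)
  | .Q => opQ _
  | .Z => 0

/-- The representation of `U` on the universal module. -/
def rep : U →ₐ[ℂ] Module.End ℂ (ℕ × ℕ →₀ (Idx i → ℂ)) :=
  RingQuot.liftAlgHom ℂ ⟨FreeAlgebra.lift ℂ (act μ i), fun x y h => by
    have hX := baseH_baseE μ i
    have hY := baseH_baseP μ i
    have h2 : FreeAlgebra.lift ℂ (act μ i) 2 = 2 := map_ofNat _ 2
    induction h <;>
      simp only [ιg, map_mul, map_add, map_sub, FreeAlgebra.lift_ι_apply, act, h2, zero_mul,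
        mul_zero, add_zero]
    · exact opH_mul_opE hX hY
    · exact opE_mul_opF
    · exact opH_mul_opF
    · exact opE_mul_opQ
    · exact opE_mul_opP hY (baseE_baseP i)
    · exact opH_mul_opP hY
    · exact opF_mul_opP
    · exact opF_mul_opQ
    · exact opH_mul_opQ
    · exact opP_mul_opQ⟩

theorem rep_gen (g : Gen) : rep μ i (gen g) = act μ i g := by
  simp [rep, gen, ιg]

instance : Module U (Univ μ i) :=
  Module.compHom (ℕ × ℕ →₀ (Idx i → ℂ)) (rep μ i).toRingHom

instance : IsScalarTower ℂ U (Univ μ i) where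
  smul_assoc a u v := by
    change rep μ i (a • u) v = a • rep μ i u v
    rw [map_smul]; rfl

theorem gen_smul (g : Gen) (v : Univ μ i) : gen g • v = act μ i g v := by
  change rep μ i (gen g) v = _
  rw [rep_gen]

end
theorem Z_mul (u : U) : Z * u = u * Z := by
  induction u using U_induction with
  | hsc a => exact (Algebra.commutes a Z).symm
  | hgen g => exact Z_mul_gen g
  | hmul x y hx hy => rw [← mul_assoc, hx, mul_assoc, hy, mul_assoc]
  | hadd x y hx hy => rw [mul_add, add_mul, hx, hy]

section

variable {μ : ℂ} {i : ℕ}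

variable (μ) in
/-- The vector `f ^ a * q ^ b ⊗ n` of the universal module. -/
def um (a b : ℕ) : (Idx i → ℂ) →ₗ[ℂ] Univ μ i := Finsupp.lsingle (a, b)

/-- The coefficient of `f ^ x.1 * q ^ x.2`. -/
def coeff (x : ℕ × ℕ) : Univ μ i →ₗ[ℂ] (Idx i → ℂ) := Finsupp.lapply x

theorem coeff_um (x : ℕ × ℕ) (a b : ℕ) (n : Idx i → ℂ) :
    coeff x (um μ a b n) = if (a, b) = x then n else 0 := Finsupp.single_apply

theorem univ_ext {v w : Univ μ i} (h : ∀ x, coeff x v = coeff x w) : v = w := Finsupp.ext h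

theorem univ_induction {p : Univ μ i → Prop} (h0 : p 0) (hadd : ∀ v w, p v → p w → p (v + w))
    (hm : ∀ a b n, p (um μ a b n)) (w : Univ μ i) : p w :=
  Finsupp.induction_linear w h0 hadd fun x n => hm x.1 x.2 n

theorem sum_um_coeff (w : Univ μ i) :
    ∃ s : Finset (ℕ × ℕ), w = ∑ x ∈ s, um μ x.1 x.2 (coeff x w) :=
  ⟨Finsupp.support w, (Finsupp.sum_single w).symm⟩

theorem F_smul_um (a b : ℕ) (n : Idx i → ℂ) : F • um μ a b n = um μ (a + 1) b n :=
  (gen_smul μ i .F _).trans (opF_mono a b n)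

theorem Q_smul_um (a b : ℕ) (n : Idx i → ℂ) : Q • um μ a b n = um μ a (b + 1) n :=
  (gen_smul μ i .Q _).trans (opQ_mono a b n)

theorem Z_smul_univ (w : Univ μ i) : Z • w = 0 := gen_smul μ i .Z w

theorem H_smul_um (a b : ℕ) (n : Idx i → ℂ) :
    H • um μ a b n = um μ a b (baseH μ i n) - (2 * a + b : ℂ) • um μ a b n :=
  (gen_smul μ i .H _).trans (opH_mono _ a b n)

theorem P_smul_um (a b : ℕ) (n : Idx i → ℂ) :
    P • um μ a b n = um μ a b (baseP i n) - (a : ℂ) • um μ (a - 1) (b + 1) n :=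
  (gen_smul μ i .P _).trans (opP_mono _ a b n)

theorem E_smul_um (a b : ℕ) (n : Idx i → ℂ) :
    E • um μ a b n = um μ a b (baseE i n) + (b : ℂ) • um μ a (b - 1) (baseP i n) +
      (a : ℂ) • (um μ (a - 1) b (baseH μ i n) - (b + a - 1 : ℂ) • um μ (a - 1) b n) :=
  (gen_smul μ i .E _).trans (opE_mono _ _ _ a b n)

theorem FQ_smul_um (a b a' b' : ℕ) (n : Idx i → ℂ) :
    (F ^ a * Q ^ b) • um μ a' b' n = um μ (a' + a) (b' + b) n := by
  have hQ : Q ^ b • um μ a' b' n = um μ a' (b' + b) n := by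
    induction b with
    | zero => simp
    | succ b ih => rw [pow_succ', mul_smul, ih, Q_smul_um, add_assoc]
  rw [mul_smul, hQ]
  induction a with
  | zero => simp
  | succ a ih => rw [pow_succ', mul_smul, ih, F_smul_um, add_assoc]

theorem coeff_H_smul (x : ℕ × ℕ) (w : Univ μ i) (y : Idx i) :
    coeff x (H • w) y =
      (μ + (2 * y.1.1 + y.1.2 : ℕ) - (2 * x.1 + x.2 : ℕ)) * coeff x w y := by
  induction w using univ_induction with
  | h0 => simp
  | hadd v w hv hw => simp only [smul_add, map_add, Pi.add_apply, hv, hw, mul_add]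
  | hm a b n =>
    rw [H_smul_um, map_sub, map_smul, coeff_um, coeff_um]
    split_ifs with h
    · subst h
      simp [baseH]; ring
    · simp

theorem eq_of_mem_wt {ν : ℂ} {w : Univ μ i} (hw : w ∈ wt (Univ μ i) ν) {x : ℕ × ℕ} {y : Idx i}
    (h : coeff x w y ≠ 0) : ν = μ + (2 * y.1.1 + y.1.2 : ℕ) - (2 * x.1 + x.2 : ℕ) := by
  rw [mem_wt] at hw
  have := coeff_H_smul x w y
  rw [hw, map_smul, Pi.smul_apply, smul_eq_mul] at this
  exact mul_right_cancel₀ h this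

theorem baseE_single {c d : ℕ} (h : 2 * c + d ≤ i) (r : ℂ) :
    baseE i (Pi.single ⟨(c, d), h⟩ r) =
      if h' : 2 * (c + 1) + d ≤ i then Pi.single ⟨(c + 1, d), h'⟩ r else 0 := by
  ext ⟨⟨_ | c', d'⟩, h''⟩
  · split_ifs <;> simp [baseE]
  · by_cases hc : c' = c ∧ d' = d
    · obtain ⟨rfl, rfl⟩ := hc
      simp [baseE, h'']
    · split_ifs <;> simp [baseE, hc]

theorem baseP_single {c d : ℕ} (h : 2 * c + d ≤ i) (r : ℂ) :
    baseP i (Pi.single ⟨(c, d), h⟩ r) =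
      if h' : 2 * c + (d + 1) ≤ i then Pi.single ⟨(c, d + 1), h'⟩ r else 0 := by
  ext ⟨⟨c', _ | d'⟩, h''⟩
  · split_ifs <;> simp [baseP]
  · by_cases hc : c' = c ∧ d' = d
    · obtain ⟨rfl, rfl⟩ := hc
      simp [baseP, h'']
    · split_ifs <;> simp [baseP, hc]

theorem baseH_single (y : Idx i) (r : ℂ) :
    baseH μ i (Pi.single y r) = (μ + (2 * y.1.1 + y.1.2 : ℕ)) • Pi.single y r := by
  ext y'
  by_cases h : y' = y
  · subst h; simp [baseH]
  · simp [baseH, h]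

variable (μ i) in
/-- The canonical generator of the universal module. -/
def univGen : Univ μ i := um μ 0 0 (Pi.single ⟨(0, 0), by simp⟩ 1)

theorem EP_smul_univGen (y : Idx i) :
    (E ^ y.1.1 * P ^ y.1.2) • univGen μ i = um μ 0 0 (Pi.single y 1) := by
  obtain ⟨⟨c, d⟩, h⟩ := y
  simp only at h ⊢
  have hP : P ^ d • univGen μ i = um μ 0 0 (Pi.single ⟨(0, d), by simp only; omega⟩ 1) := by
    induction d with
    | zero => simp [univGen]
    | succ d ih =>
      rw [pow_succ', mul_smul, ih (by omega), P_smul_um, baseP_single, dif_pos (by omega)]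
      simp
  rw [mul_smul, hP]
  clear hP
  induction c with
  | zero => simp
  | succ c ih =>
    rw [pow_succ', mul_smul, ih (by omega), E_smul_um, baseE_single, dif_pos (by omega)]
    simp

theorem um_single (a b : ℕ) (y : Idx i) (r : ℂ) :
    um μ a b (Pi.single y r) =
      r • (F ^ a * Q ^ b) • (E ^ y.1.1 * P ^ y.1.2) • univGen μ i := by
  rw [EP_smul_univGen, FQ_smul_um, ← map_smul, zero_add, zero_add, ← Pi.single_smul, smul_eq_mul,
    mul_one]

/-- Every vector is a combination of the monomials applied to the generator. -/
theorem um_eq_sum [Fintype (Idx i)] (a b : ℕ) (n : Idx i → ℂ) :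
    um μ a b n = ∑ y, n y • (F ^ a * Q ^ b) • (E ^ y.1.1 * P ^ y.1.2) • univGen μ i := by
  classical
  simp_rw [← um_single]
  rw [← map_sum, Finset.univ_sum_single]

theorem univGen_mem_wt : univGen μ i ∈ wt (Univ μ i) μ := by
  rw [mem_wt, univGen, H_smul_um, baseH_single]
  simp

theorem span_univGen : Submodule.span U {univGen μ i} = ⊤ := by
  have := Fintype.ofFinite (Idx i)
  refine eq_top_iff.2 fun w _ => ?_
  induction w using univ_induction with
  | h0 => exact zero_mem _
  | hadd v w hv hw => exact add_mem (hv trivial) (hw trivial)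
  | hm a b n =>
    rw [um_eq_sum]
    refine sum_mem fun y _ => ?_
    exact Submodule.smul_of_tower_mem _ _ (Submodule.smul_mem _ _ (Submodule.smul_mem _ _
      (Submodule.mem_span_singleton_self _)))

section Lift

variable {M : Type} [AddCommGroup M] [Module U M] [Module ℂ M] [IsScalarTower ℂ U M] {m : M}

variable (i m) in
/-- The value of the universal map on `U(n₊)`. -/
def liftBase [Fintype (Idx i)] : (Idx i → ℂ) →ₗ[ℂ] M :=
  Fintype.linearCombination ℂ fun y => (E ^ y.1.1 * P ^ y.1.2) • m

omit [IsScalarTower ℂ U M] in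
theorem liftBase_single [Fintype (Idx i)] (y : Idx i) (r : ℂ) :
    liftBase i m (Pi.single y r) = r • (E ^ y.1.1 * P ^ y.1.2) • m := by
  classical
  exact Fintype.linearCombination_apply_single ℂ _ y r

variable (μ i m) in
/-- The universal map, as a `ℂ`-linear map. -/
def liftAux [Fintype (Idx i)] : Univ μ i →ₗ[ℂ] M :=
  Finsupp.lsum (M := Idx i → ℂ) ℂ fun x : ℕ × ℕ =>
    (Algebra.lsmul ℂ ℂ M (F ^ x.1 * Q ^ x.2)) ∘ₗ liftBase i m

theorem liftAux_um [Fintype (Idx i)] (a b : ℕ) (n : Idx i → ℂ) :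
    liftAux μ i m (um μ a b n) = (F ^ a * Q ^ b) • liftBase i m n := by
  change Finsupp.lsum (M := Idx i → ℂ) ℂ _ (Finsupp.single (a, b) n) = _
  rw [Finsupp.lsum_single]
  rfl

theorem liftBase_baseH [Fintype (Idx i)] (hm : m ∈ wt M μ) (n : Idx i → ℂ) :
    liftBase i m (baseH μ i n) = H • liftBase i m n := by
  classical
  have : liftBase i m ∘ₗ baseH μ i = Algebra.lsmul ℂ ℂ M H ∘ₗ liftBase i m := by
    refine LinearMap.pi_ext fun y r => ?_
    have h := mem_wt.1 (EP_smul_mem_wt hm y.1.1 y.1.2)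
    simp only [LinearMap.comp_apply, baseH_single, map_smul, liftBase_single,
      Algebra.lsmul_coe, h]
    exact smul_comm _ _ _
  exact LinearMap.congr_fun this n

theorem liftBase_baseE [Fintype (Idx i)] (ht : ∀ c d, i < 2 * c + d → (E ^ c * P ^ d) • m = 0)
    (n : Idx i → ℂ) : liftBase i m (baseE i n) = E • liftBase i m n := by
  classical
  have : liftBase i m ∘ₗ baseE i = Algebra.lsmul ℂ ℂ M E ∘ₗ liftBase i m := by
    refine LinearMap.pi_ext fun y r => ?_
    obtain ⟨⟨c, d⟩, h⟩ := y
    simp only [LinearMap.comp_apply, baseE_single, map_smul, liftBase_single, Algebra.lsmul_coe]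
    rw [← mul_smul, ← mul_assoc, ← pow_succ']
    split_ifs with h'
    · rw [liftBase_single]
    · rw [ht _ _ (by omega), map_zero, smul_zero]
  exact LinearMap.congr_fun this n

theorem liftBase_baseP [Fintype (Idx i)] (ht : ∀ c d, i < 2 * c + d → (E ^ c * P ^ d) • m = 0)
    (n : Idx i → ℂ) : liftBase i m (baseP i n) = P • liftBase i m n := by
  classical
  have : liftBase i m ∘ₗ baseP i = Algebra.lsmul ℂ ℂ M P ∘ₗ liftBase i m := by
    refine LinearMap.pi_ext fun y r => ?_
    obtain ⟨⟨c, d⟩, h⟩ := y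
    have hc : P * E ^ c = E ^ c * P := ((show Commute E P from E_mul_P).pow_left c).symm
    simp only [LinearMap.comp_apply, baseP_single, map_smul, liftBase_single, Algebra.lsmul_coe]
    rw [← mul_smul, ← mul_assoc, hc, mul_assoc, ← pow_succ']
    split_ifs with h'
    · rw [liftBase_single]
    · rw [ht _ _ (by omega), map_zero, smul_zero]
  exact LinearMap.congr_fun this n

theorem liftAux_F_smul [Fintype (Idx i)] (w : Univ μ i) :
    liftAux μ i m (F • w) = F • liftAux μ i m w := by
  induction w using univ_induction with
  | h0 => simp
  | hadd v w hv hw => rw [smul_add, map_add, map_add, hv, hw, smul_add]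
  | hm a b n => rw [F_smul_um, liftAux_um, liftAux_um, ← mul_smul, ← mul_assoc, ← pow_succ']

theorem liftAux_Q_smul [Fintype (Idx i)] (w : Univ μ i) :
    liftAux μ i m (Q • w) = Q • liftAux μ i m w := by
  induction w using univ_induction with
  | h0 => simp
  | hadd v w hv hw => rw [smul_add, map_add, map_add, hv, hw, smul_add]
  | hm a b n =>
    have hc : Q * F ^ a = F ^ a * Q := ((show Commute F Q from F_mul_Q).pow_left a).symm
    rw [Q_smul_um, liftAux_um, liftAux_um, ← mul_smul, ← mul_assoc, hc, mul_assoc, ← pow_succ']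

theorem liftAux_nonneg_smul [Fintype (Idx i)] (hm : m ∈ wt M μ) (hZ : Z • m = 0)
    (ht : ∀ c d, i < 2 * c + d → (E ^ c * P ^ d) • m = 0) (w : Univ μ i) :
    liftAux μ i m (E • w) = E • liftAux μ i m w ∧ liftAux μ i m (H • w) = H • liftAux μ i m w ∧
      liftAux μ i m (P • w) = P • liftAux μ i m w ∧ Z • liftAux μ i m w = 0 := by
  induction w using univ_induction with
  | h0 => simp
  | hadd v w hv hw =>
    simp only [smul_add, map_add, hv, hw, add_zero, and_self]
  | hm a b n =>
    induction a with
    | zero =>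
      induction b with
      | zero =>
        refine ⟨?_, ?_, ?_, ?_⟩
        · simp [E_smul_um, liftAux_um, liftBase_baseE ht]
        · simp [H_smul_um, liftAux_um, liftBase_baseH hm]
        · simp [P_smul_um, liftAux_um, liftBase_baseP ht]
        · rw [liftAux_um, ← mul_smul, Z_mul, mul_smul]
          simp only [liftBase, Fintype.linearCombination_apply, Finset.smul_sum]
          refine Finset.sum_eq_zero fun y _ => ?_
          rw [smul_comm_U Z, ← mul_smul Z, Z_mul, mul_smul _ Z, hZ, smul_zero, smul_zero, smul_zero]
      | succ b ih =>
        obtain ⟨hE, hH, hP, hZ'⟩ := ih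
        rw [← Q_smul_um]
        refine ⟨?_, ?_, ?_, ?_⟩
        · rw [liftAux_Q_smul, ← mul_smul, ← mul_smul, E_mul_Q, add_smul, add_smul, mul_smul,
            mul_smul, map_add, liftAux_Q_smul, hE, hP]
        · rw [liftAux_Q_smul, ← mul_smul, ← mul_smul, H_mul_Q, sub_smul, sub_smul, mul_smul,
            mul_smul, map_sub, liftAux_Q_smul, liftAux_Q_smul, hH]
        · rw [liftAux_Q_smul, ← mul_smul, ← mul_smul, P_mul_Q, add_smul, add_smul, mul_smul,
            mul_smul, map_add, liftAux_Q_smul, hP, Z_smul_univ, hZ', map_zero]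
        · rw [liftAux_Q_smul, ← mul_smul, Z_mul, mul_smul, hZ', smul_zero]
    | succ a ih =>
      obtain ⟨hE, hH, hP, hZ'⟩ := ih
      have hHF : H * F = F * H - (F + F) := by rw [H_mul_F, two_mul]
      have hPF : P * F = F * P - Q := by rw [F_mul_P, add_sub_cancel_right]
      rw [← F_smul_um]
      refine ⟨?_, ?_, ?_, ?_⟩
      · rw [liftAux_F_smul, ← mul_smul, ← mul_smul, E_mul_F, add_smul, add_smul, mul_smul,
          mul_smul, map_add, liftAux_F_smul, hE, hH]
      · rw [liftAux_F_smul, ← mul_smul, ← mul_smul, hHF, sub_smul, sub_smul, mul_smul,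
          mul_smul, add_smul, add_smul, map_sub, map_add, liftAux_F_smul,
          liftAux_F_smul, hH]
      · rw [liftAux_F_smul, ← mul_smul, ← mul_smul, hPF, sub_smul, sub_smul, mul_smul,
          mul_smul, map_sub, liftAux_F_smul, hP, liftAux_Q_smul]
      · rw [liftAux_F_smul, ← mul_smul, Z_mul, mul_smul, hZ', smul_zero]

/-- The universal property of the universal module. -/
theorem exists_univ_lift (hm : m ∈ wt M μ) (hZ : Z • m = 0)
    (ht : ∀ c d, i < 2 * c + d → (E ^ c * P ^ d) • m = 0) :
    ∃ T : Univ μ i →ₗ[U] M, T (univGen μ i) = m := by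
  have := Fintype.ofFinite (Idx i)
  have h := liftAux_nonneg_smul hm hZ ht
  refine ⟨linearMapOfGen (liftAux μ i m) fun g w => ?_, ?_⟩
  · cases g
    · exact (h w).1
    · exact (h w).2.1
    · exact liftAux_F_smul w
    · exact (h w).2.2.1
    · exact liftAux_Q_smul w
    · have h1 := Z_smul_univ w
      have h2 := (h w).2.2.2
      change liftAux μ i m (Z • w) = Z • _
      rw [h1, h2, map_zero]
  · rw [linearMapOfGen_apply, univGen, liftAux_um, liftBase_single]
    simp

omit [Module ℂ M] [IsScalarTower ℂ U M] in
theorem hom_ext_univ {S T : Univ μ i →ₗ[U] M} (h : S (univGen μ i) = T (univGen μ i)) : S = T :=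
  LinearMap.ext_on span_univGen (by simpa using h)

end Lift

end
/-! ### The truncated category -/

section

variable {M : Type} [AddCommGroup M] [Module U M] [Module ℂ M] [IsScalarTower ℂ U M]

theorem cmod_eq : cmod M = ‹Module ℂ M› :=
  Module.ext' _ _ fun r m => algebraMap_smul U r m

theorem iSup_wt_eq_top
    (h : ∀ v : M, v ∈ AddSubgroup.closure {w : M | ∃ hh zz : ℂ, IsWeightVec hh zz w}) :
    ⨆ κ, wt M κ = ⊤ := by
  refine eq_top_iff.2 fun v _ => ?_
  refine (AddSubgroup.closure_le (K := (⨆ κ, wt M κ).toAddSubgroup)).2 ?_ (h v)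
  rintro w ⟨hh, zz, hw⟩
  exact Submodule.mem_iSup_of_mem hh (isWeightVec_iff.1 hw).1

theorem Z_smul_of_weights {hh0 : ℂ}
    (h : ∀ v : M, v ∈ AddSubgroup.closure {w : M | ∃ hh zz : ℂ, IsWeightVec hh zz w})
    (h' : ∀ (v : M) (hh zz : ℂ), v ≠ 0 → IsWeightVec hh zz v → zz = 0 ∧ ∃ n : ℤ, hh = hh0 + n)
    (v : M) : Z • v = 0 := by
  induction h v using AddSubgroup.closure_induction with
  | mem w hw =>
    obtain ⟨hh, zz, hw⟩ := hw
    by_cases h0 : w = 0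
    · rw [h0, smul_zero]
    · have := (isWeightVec_iff.1 hw).2
      rwa [(h' w hh zz h0 hw).1, zero_smul] at this
  | zero => exact smul_zero _
  | add v w _ _ hv hw => rw [smul_add, hv, hw, add_zero]
  | neg v _ hv => rw [smul_neg, hv, neg_zero]

/-- What membership in the truncated category means for a `U`-module. -/
theorem inTrunc_data {hh0 : ℂ} (h : InTrunc hh0 (ModuleCat.of U M)) :
    (∀ v : M, Z • v = 0) ∧ ⨆ κ, wt M κ = ⊤ ∧
      ∀ n : ℕ, 1 ≤ n → ∀ v ∈ wt M (hh0 + n), v = 0 := by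
  obtain ⟨⟨⟨-, h1, -⟩, h2⟩, h3⟩ := h
  have hZ : ∀ v : M, Z • v = 0 := Z_smul_of_weights h1 h2
  refine ⟨hZ, iSup_wt_eq_top h1, fun n hn v hv => h3 v n hn ?_⟩
  exact isWeightVec_iff.2 ⟨hv, by rw [zero_smul]; exact hZ v⟩

end

section

variable {μ : ℂ} {i : ℕ}

/-- Vectors all of whose monomials `f ^ a * q ^ b` have `2 * a + b ≤ k`. -/
def depth (μ : ℂ) (i k : ℕ) : Submodule ℂ (Univ μ i) where
  carrier := {w | ∀ x : ℕ × ℕ, k < 2 * x.1 + x.2 → coeff x w = 0}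
  add_mem' hv hw x hx := by rw [map_add, hv x hx, hw x hx, add_zero]
  zero_mem' _ _ := map_zero _
  smul_mem' r v hv x hx := by rw [map_smul, hv x hx, smul_zero]

theorem um_mem_depth {k a b : ℕ} (h : 2 * a + b ≤ k) (n : Idx i → ℂ) :
    um μ a b n ∈ depth μ i k := by
  rintro ⟨x, y⟩ hx
  rw [coeff_um, if_neg]
  rintro ⟨⟩
  simp only at hx
  omega

instance (k : ℕ) : FiniteDimensional ℂ (depth μ i k) := by
  let T : Univ μ i →ₗ[ℂ] (Idx k → Idx i → ℂ) := LinearMap.pi fun x => coeff x.1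
  refine FiniteDimensional.of_injective (T ∘ₗ (depth μ i k).subtype) fun v w h => ?_
  refine Subtype.ext (univ_ext fun x => ?_)
  by_cases hx : 2 * x.1 + x.2 ≤ k
  · exact congrFun h ⟨x, hx⟩
  · rw [v.2 x (not_le.1 hx), w.2 x (not_le.1 hx)]

theorem exists_mem_depth (w : Univ μ i) : ∃ k, w ∈ depth μ i k := by
  obtain ⟨s, hs⟩ := sum_um_coeff w
  refine ⟨s.sup fun x => 2 * x.1 + x.2, ?_⟩
  rw [hs]
  exact sum_mem fun x hx =>
    um_mem_depth (Finset.le_sup (f := fun x : ℕ × ℕ => 2 * x.1 + x.2) hx) _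

theorem nPlus_smul_mem_depth {k : ℕ} {u : U} (hu : u ∈ nPlus) :
    ∀ w ∈ depth μ i k, u • w ∈ depth μ i k := by
  have key : ∀ g : U, (∀ a b (n : Idx i → ℂ), 2 * a + b ≤ k → g • um μ a b n ∈ depth μ i k) →
      ∀ w ∈ depth μ i k, g • w ∈ depth μ i k := by
    intro g hg w hw
    obtain ⟨s, hs⟩ := sum_um_coeff w
    rw [hs, Finset.smul_sum]
    refine sum_mem fun x _ => ?_
    by_cases hx : 2 * x.1 + x.2 ≤ k
    · exact hg _ _ _ hx
    · rw [hw x (not_le.1 hx), map_zero, smul_zero]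
      exact zero_mem _
  induction hu using Algebra.adjoin_induction with
  | mem u hu =>
    rcases hu with rfl | rfl
    · refine key _ fun a b n h => ?_
      rw [E_smul_um]
      refine add_mem (add_mem (um_mem_depth h _) (Submodule.smul_mem _ _ (um_mem_depth ?_ _)))
        (Submodule.smul_mem _ _ (sub_mem (um_mem_depth ?_ _)
          (Submodule.smul_mem _ _ (um_mem_depth ?_ _)))) <;> omega
    · refine key _ fun a b n h => ?_
      rw [P_smul_um]
      rcases a with _ | a
      · simpa using um_mem_depth h _
      · refine sub_mem (um_mem_depth h _) (Submodule.smul_mem _ _ (um_mem_depth ?_ _))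
        omega
  | algebraMap r => intro w hw; rw [algebraMap_smul]; exact Submodule.smul_mem _ _ hw
  | add x y _ _ hx hy => intro w hw; rw [add_smul]; exact add_mem (hx w hw) (hy w hw)
  | mul x y _ _ hx hy => intro w hw; rw [mul_smul]; exact hx _ (hy w hw)

theorem iSup_wt_univ : ⨆ κ, wt (Univ μ i) κ = ⊤ := by
  have := Fintype.ofFinite (Idx i)
  refine eq_top_iff.2 fun w _ => ?_
  induction w using univ_induction with
  | h0 => exact zero_mem _
  | hadd v w hv hw => exact add_mem (hv trivial) (hw trivial)
  | hm a b n =>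
    rw [um_eq_sum]
    refine sum_mem fun y _ => Submodule.smul_mem _ _ ?_
    exact Submodule.mem_iSup_of_mem _ (FQ_smul_mem_wt (EP_smul_mem_wt univGen_mem_wt _ _) _ _)

variable {M : Type} [AddCommGroup M] [Module U M] [Module ℂ M] [IsScalarTower ℂ U M]

instance : Module.Finite U (Univ μ i) :=
  ⟨⟨{univGen μ i}, by rw [Finset.coe_singleton, span_univGen]⟩⟩

theorem exists_coeff_ne_zero {w : Univ μ i} (hw : w ≠ 0) : ∃ x y, coeff x w y ≠ 0 := by
  by_contra! h
  exact hw (univ_ext fun x => by ext y; simp [h x y])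

theorem inTrunc_of_surjective {hh0 : ℂ} {i : ℕ} (f : Univ (hh0 - i) i →ₗ[U] M)
    (hf : Function.Surjective f) : InTrunc hh0 (ModuleCat.of U M) := by
  have hZ : ∀ v : M, Z • v = 0 := fun v => by
    obtain ⟨w, rfl⟩ := hf v
    rw [← map_smul, Z_smul_univ, map_zero]
  have hw : ∀ (v : M) (hh zz : ℂ), v ≠ 0 → IsWeightVec hh zz v → zz = 0 ∧
      ∃ (x : ℕ × ℕ) (y : Idx i),
        hh = hh0 - i + (2 * y.1.1 + y.1.2 : ℕ) - (2 * x.1 + x.2 : ℕ) := by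
    intro v hh zz hv h
    obtain ⟨h1, h2⟩ := isWeightVec_iff.1 h
    rw [hZ] at h2
    obtain ⟨w, hw, rfl⟩ := exists_lift_wt iSup_wt_univ f hf h1
    obtain ⟨x, y, hxy⟩ := exists_coeff_ne_zero (fun h0 : w = 0 => hv (by rw [h0, map_zero]))
    exact ⟨(smul_eq_zero.1 h2.symm).resolve_right hv, x, y, eq_of_mem_wt hw hxy⟩
  refine ⟨⟨⟨Module.Finite.of_surjective f hf, fun v => ?_, ?_⟩, fun v hh zz hv h => ?_⟩,
    fun v n hn h => ?_⟩
  · have : v ∈ ⨆ κ, wt M κ := by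
      rw [map_wt_top iSup_wt_univ f hf]; exact Submodule.mem_top
    refine Submodule.iSup_induction (wt M)
      (motive := fun v => v ∈ AddSubgroup.closure {w : M | ∃ hh zz : ℂ, IsWeightVec hh zz w}) this
      (fun κ w hw => ?_) (zero_mem _) fun _ _ => add_mem
    exact AddSubgroup.subset_closure
      ⟨κ, 0, isWeightVec_iff.2 ⟨hw, by rw [zero_smul]; exact hZ w⟩⟩
  · rw [cmod_eq (M := M)]
    intro v
    obtain ⟨w, rfl⟩ := hf v
    obtain ⟨k, hk⟩ := exists_mem_depth w
    refine ⟨(depth _ i k).map (f.restrictScalars ℂ), inferInstance, fun u hu => ?_⟩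
    exact ⟨u • w, nPlus_smul_mem_depth hu w hk, f.map_smul u w⟩
  · obtain ⟨h1, x, y, h2⟩ := hw v hh zz hv h
    refine ⟨h1, -i + (2 * y.1.1 + y.1.2 : ℕ) - (2 * x.1 + x.2 : ℕ), ?_⟩
    rw [h2]; push_cast; ring
  · by_contra hv
    obtain ⟨-, x, y, h2⟩ := hw v _ _ hv h
    have h3 : ((n + i + (2 * x.1 + x.2) : ℕ) : ℂ) = (2 * y.1.1 + y.1.2 : ℕ) := by
      push_cast at h2 ⊢
      linear_combination h2
    have := Nat.cast_injective h3
    have := y.2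
    omega

/-- Homomorphisms out of the universal module lift along surjections in the truncated category. -/
theorem projInTrunc_univ (hh0 : ℂ) (i : ℕ) :
    ProjInTrunc hh0 (ModuleCat.of U (Univ (hh0 - i) i)) := by
  intro M N hM hN g hg f
  let _ := cmod M
  let _ := cmod N
  have : IsScalarTower ℂ U M := .of_algebraMap_smul fun _ _ => rfl
  have : IsScalarTower ℂ U N := .of_algebraMap_smul fun _ _ => rfl
  obtain ⟨hZ, hM1, hM2⟩ := inTrunc_data (M := M) hM
  obtain ⟨m, hm, hgm⟩ := exists_lift_wt hM1 g hg (map_mem_wt f univGen_mem_wt)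
  obtain ⟨T, hT⟩ := exists_univ_lift (i := i) hm (hZ m) fun c d hcd => by
    refine hM2 (2 * c + d - i) (by omega) _ ?_
    convert EP_smul_mem_wt hm c d using 2
    rw [Nat.cast_sub hcd.le]
    ring
  exact ⟨T, hom_ext_univ (by rw [LinearMap.comp_apply, hT, hgm])⟩

theorem ProjInTrunc.retract {hh0 : ℂ} {A B : Type} [AddCommGroup A] [Module U A]
    [AddCommGroup B] [Module U B] (hA : ProjInTrunc hh0 (ModuleCat.of U A)) (ι : B →ₗ[U] A)
    (r : A →ₗ[U] B) (h : r ∘ₗ ι = LinearMap.id) : ProjInTrunc hh0 (ModuleCat.of U B) := by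
  intro M N hM hN g hg f
  obtain ⟨f', hf'⟩ := hA M N hM hN g hg (f ∘ₗ r)
  refine ⟨f' ∘ₗ ι, ?_⟩
  rw [← LinearMap.comp_assoc, hf', LinearMap.comp_assoc, h, LinearMap.comp_id]

end
/-! ### Verma modules -/

section

variable (μ : ℂ)

theorem smul_hwVec_eq_zero {u : U} (hu : u ∈ ({E, P, H - sc μ, Z - sc 0} : Set U)) :
    u • hwVec μ 0 = 0 := by
  rw [hwVec, ← Submodule.Quotient.mk_smul, Submodule.Quotient.mk_eq_zero, smul_eq_mul, mul_one]
  exact Submodule.subset_span hu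

theorem E_smul_hwVec : E • hwVec μ 0 = 0 := smul_hwVec_eq_zero μ (by simp)

theorem P_smul_hwVec : P • hwVec μ 0 = 0 := smul_hwVec_eq_zero μ (by simp)

theorem hwVec_mem_wt : hwVec μ 0 ∈ wt (Verma μ 0) μ := by
  have := smul_hwVec_eq_zero μ (u := H - sc μ) (by simp)
  rwa [sub_smul, sc_smul, sub_eq_zero, ← mem_wt] at this

theorem Z_smul_hwVec : Z • hwVec μ 0 = 0 := by
  have := smul_hwVec_eq_zero μ (u := Z - sc 0) (by simp)
  rwa [sub_smul, sc_smul, zero_smul, sub_zero] at this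

theorem span_hwVec : Submodule.span U {hwVec μ 0} = ⊤ := by
  refine eq_top_iff.2 fun w _ => ?_
  obtain ⟨u, rfl⟩ := Submodule.Quotient.mk_surjective _ w
  refine Submodule.mem_span_singleton.2 ⟨u, ?_⟩
  rw [hwVec, ← Submodule.Quotient.mk_smul, smul_eq_mul, mul_one]

variable {μ}

theorem exists_verma_lift {M : Type} [AddCommGroup M] [Module U M] [Module ℂ M]
    [IsScalarTower ℂ U M] {m : M} (hE : E • m = 0) (hP : P • m = 0) (hm : m ∈ wt M μ)
    (hZ : Z • m = 0) : ∃ T : Verma μ 0 →ₗ[U] M, T (hwVec μ 0) = m := by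
  refine ⟨(vermaIdeal μ 0).liftQ (LinearMap.toSpanSingleton U M m) ?_, ?_⟩
  · rw [vermaIdeal, Submodule.span_le]
    rintro u (rfl | rfl | rfl | rfl) <;>
      simp only [SetLike.mem_coe, LinearMap.mem_ker, LinearMap.toSpanSingleton_apply]
    · exact hE
    · exact hP
    · rw [sub_smul, sc_smul, mem_wt.1 hm, sub_self]
    · rw [sub_smul, sc_smul, hZ, zero_smul, sub_self]
  · rw [hwVec, Submodule.liftQ_apply, LinearMap.toSpanSingleton_apply, one_smul]

theorem EP_smul_hwVec {c d : ℕ} (h : 0 < 2 * c + d) : (E ^ c * P ^ d) • hwVec μ 0 = 0 := by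
  rcases d with _ | d
  · obtain ⟨c, rfl⟩ : ∃ c', c = c' + 1 := ⟨c - 1, by omega⟩
    rw [pow_zero, mul_one, pow_succ, mul_smul, E_smul_hwVec, smul_zero]
  · rw [pow_succ, ← mul_assoc, mul_smul, P_smul_hwVec, smul_zero]

theorem exists_univ_to_verma (μ : ℂ) (i : ℕ) :
    ∃ T : Univ μ i →ₗ[U] Verma μ 0, T (univGen μ i) = hwVec μ 0 :=
  exists_univ_lift (hwVec_mem_wt μ) (Z_smul_hwVec μ) fun _ _ h => EP_smul_hwVec (by omega)

theorem surjective_of_hwVec {M : Type} [AddCommGroup M] [Module U M] {T : M →ₗ[U] Verma μ 0}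
    {m : M} (h : T m = hwVec μ 0) : Function.Surjective T := by
  rw [← LinearMap.range_eq_top, eq_top_iff, ← span_hwVec, Submodule.span_singleton_le_iff_mem]
  exact ⟨m, h⟩

theorem exists_verma_expansion (w : Verma μ 0) :
    ∃ c : ℕ × ℕ →₀ ℂ, w = c.sum fun x r => r • (F ^ x.1 * Q ^ x.2) • hwVec μ 0 := by
  have := Fintype.ofFinite (Idx 0)
  obtain ⟨T, hT⟩ := exists_univ_to_verma μ 0
  obtain ⟨v, rfl⟩ := surjective_of_hwVec hT w
  induction v using univ_induction with
  | h0 => exact ⟨0, by simp⟩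
  | hadd v w hv hw =>
    obtain ⟨c, hc⟩ := hv
    obtain ⟨c', hc'⟩ := hw
    refine ⟨c + c', ?_⟩
    rw [map_add, hc, hc', Finsupp.sum_add_index' (by simp) (by simp [add_smul])]
  | hm a b n =>
    refine ⟨Finsupp.single (a, b) (n ⟨(0, 0), by simp⟩), ?_⟩
    rw [Finsupp.sum_single_index (by simp), um_eq_sum, map_sum,
      Finset.sum_eq_single ⟨(0, 0), by simp⟩]
    · simp [LinearMap.map_smul_of_tower, hT]
    · rintro ⟨⟨c, d⟩, h⟩ - h'
      refine absurd (Subtype.ext (Prod.ext ?_ ?_)) h' <;> simp only at h ⊢ <;> omega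
    · simp

theorem hwVec_ne_zero : hwVec μ 0 ≠ 0 := by
  intro h
  obtain ⟨T, hT⟩ := exists_verma_lift (μ := μ) (m := univGen μ 0)
    (by
      rw [univGen, E_smul_um, baseE_single]
      simp)
    (by
      rw [univGen, P_smul_um, baseP_single]
      simp) univGen_mem_wt (Z_smul_univ _)
  rw [h, map_zero] at hT
  have := congrFun (congrArg (coeff (0, 0)) hT) ⟨(0, 0), by simp⟩
  rw [univGen, coeff_um] at this
  simp at this

theorem exists_smul_hwVec_add (w : Verma μ 0) :
    ∃ (r : ℂ), ∃ b ∈ ⨆ κ ≠ μ, wt (Verma μ 0) κ, w = r • hwVec μ 0 + b := by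
  obtain ⟨c, rfl⟩ := exists_verma_expansion w
  induction c using Finsupp.induction_linear with
  | zero => exact ⟨0, 0, zero_mem _, by simp⟩
  | add c c' hc hc' =>
    obtain ⟨r, b, hb, h⟩ := hc
    obtain ⟨r', b', hb', h'⟩ := hc'
    refine ⟨r + r', b + b', add_mem hb hb', ?_⟩
    rw [Finsupp.sum_add_index' (by simp) (by simp [add_smul]), h, h', add_smul]
    abel
  | single x r =>
    rw [Finsupp.sum_single_index (by simp)]
    by_cases hx : 2 * x.1 + x.2 = 0
    · have h1 : x.1 = 0 := by omega
      have h2 : x.2 = 0 := by omega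
      exact ⟨r, 0, zero_mem _, by simp [h1, h2]⟩
    · refine ⟨0, _, ?_, by rw [zero_smul, zero_add]⟩
      refine Submodule.smul_mem _ _ (Submodule.mem_iSup_of_mem (μ - (2 * x.1 + x.2 : ℕ))
        (Submodule.mem_iSup_of_mem ?_ (FQ_smul_mem_wt (hwVec_mem_wt μ) _ _)))
      rw [Ne, sub_eq_self, Nat.cast_eq_zero]
      exact hx

/-- Proper submodules of a Verma module avoid the highest weight. -/
theorem mem_iSup_wt_of_ne_top {N : Submodule U (Verma μ 0)} (hN : N ≠ ⊤) {n : Verma μ 0}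
    (hn : n ∈ N) : n ∈ ⨆ κ ≠ μ, wt (Verma μ 0) κ := by
  obtain ⟨r, b, hb, rfl⟩ := exists_smul_hwVec_add n
  by_cases hr : r = 0
  · rwa [hr, zero_smul, zero_add]
  refine absurd ?_ hN
  have h1 : N.mkQ (r • hwVec μ 0) + N.mkQ b = 0 := by
    rw [← map_add, Submodule.mkQ_apply, Submodule.Quotient.mk_eq_zero]
    exact hn
  have h2 : N.mkQ (r • hwVec μ 0) ∈ ⨆ κ ≠ μ, wt (Verma μ 0 ⧸ N) κ := by
    rw [eq_neg_of_add_eq_zero_left h1]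
    exact neg_mem (map_mem_iSup_wt _ hb)
  have h3 := Submodule.disjoint_def.1 (disjoint_wt _ μ) _
    (map_mem_wt N.mkQ (Submodule.smul_mem _ r (hwVec_mem_wt μ))) h2
  rw [LinearMap.map_smul_of_tower, smul_eq_zero, Submodule.mkQ_apply,
    Submodule.Quotient.mk_eq_zero] at h3
  rw [eq_top_iff, ← span_hwVec, Submodule.span_singleton_le_iff_mem]
  exact h3.resolve_left hr

theorem le_vermaRad {N : Submodule U (Verma μ 0)} (hN : N ≠ ⊤) : N ≤ vermaRad μ 0 := le_sSup hN

theorem vermaRad_ne_top : vermaRad μ 0 ≠ ⊤ := by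
  intro h
  have h1 : hwVec μ 0 ∈ vermaRad μ 0 := h ▸ Submodule.mem_top
  rw [vermaRad, sSup_eq_iSup'] at h1
  refine hwVec_ne_zero (Submodule.disjoint_def.1 (disjoint_wt (Verma μ 0) μ) _ (hwVec_mem_wt μ) ?_)
  exact Submodule.iSup_induction (fun N : {N : Submodule U (Verma μ 0) | N ≠ ⊤} => N.1)
    (motive := fun w => w ∈ ⨆ κ ≠ μ, wt (Verma μ 0) κ) h1
    (fun N w hw => mem_iSup_wt_of_ne_top N.2 hw) (zero_mem _) fun _ _ => add_mem

theorem sup_eq_top {A B : Submodule U (Verma μ 0)} (h : A ⊔ B = ⊤) : A = ⊤ ∨ B = ⊤ := by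
  by_contra! h'
  exact vermaRad_ne_top (eq_top_iff.2 (h ▸ sup_le (le_vermaRad h'.1) (le_vermaRad h'.2)))

end
/-! ### Submodules generated by the top weight spaces -/

section

variable {M : Type} [AddCommGroup M] [Module U M] [Module ℂ M] [IsScalarTower ℂ U M]
  {N : Type} [AddCommGroup N] [Module U N] [Module ℂ N] [IsScalarTower ℂ U N]
  {hh0 : ℂ} {i k : ℕ}

variable (M hh0 k) in
/-- The submodule generated by the weight spaces of weight `hh0 - j` with `j < k`. -/
def topPart : Submodule U M := Submodule.span U {v | ∃ j < k, v ∈ wt M (hh0 - j)}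

theorem mem_topPart {j : ℕ} (hj : j < k) {v : M} (hv : v ∈ wt M (hh0 - j)) :
    v ∈ topPart M hh0 k := Submodule.subset_span ⟨j, hj, hv⟩

theorem map_mem_topPart (f : M →ₗ[U] N) {v : M} (hv : v ∈ topPart M hh0 k) :
    f v ∈ topPart N hh0 k := by
  suffices topPart M hh0 k ≤ (topPart N hh0 k).comap f from this hv
  refine Submodule.span_le.2 ?_
  rintro v ⟨j, hj, hv⟩
  exact mem_topPart hj (map_mem_wt f hv)

theorem topPart_zero : topPart M hh0 0 = ⊥ := by simp [topPart]

theorem topPart_succ : topPart M hh0 (k + 1) =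
    topPart M hh0 k ⊔ Submodule.span U (wt M (hh0 - k) : Set M) := by
  rw [topPart, topPart, ← Submodule.span_union]
  congr 1
  ext v
  simp only [Set.mem_ofPred_eq, Set.mem_union, SetLike.mem_coe, Nat.lt_succ_iff_lt_or_eq]
  constructor
  · rintro ⟨j, hj | rfl, hv⟩
    · exact .inl ⟨j, hj, hv⟩
    · exact .inr hv
  · rintro (⟨j, hj, hv⟩ | hv)
    · exact ⟨j, .inl hj, hv⟩
    · exact ⟨k, .inr rfl, hv⟩

theorem mem_topPart_of_mem_wt_add (htop : ∀ n : ℕ, 1 ≤ n → ∀ v ∈ wt M (hh0 + n), v = 0)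
    {n : ℕ} (hn : 1 ≤ n) {v : M} (hv : v ∈ wt M (hh0 - k + n)) : v ∈ topPart M hh0 k := by
  by_cases h : n ≤ k
  · refine mem_topPart (j := k - n) (by omega) ?_
    rwa [Nat.cast_sub h, sub_sub_eq_add_sub, add_sub_right_comm]
  · rw [htop (n - k) (by omega) v (by
      rwa [Nat.cast_sub (by omega), add_sub_assoc', add_sub_right_comm])]
    exact zero_mem _

variable (M hh0 k) in
/-- The lowering operators act freely on the weight space of weight `hh0 - k`, modulo the
submodule generated by the higher weight spaces. -/
def FreeBelow : Prop := ∀ s : ℕ × ℕ →₀ M, (∀ x, s x ∈ wt M (hh0 - k)) →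
  s.sum (fun x v => (F ^ x.1 * Q ^ x.2) • v) ∈ topPart M hh0 k → ∀ x, s x ∈ topPart M hh0 k

theorem FreeBelow.retract (h : FreeBelow M hh0 k) {ι : N →ₗ[U] M} {r : M →ₗ[U] N}
    (hr : r ∘ₗ ι = LinearMap.id) : FreeBelow N hh0 k := by
  intro s hs hsum x
  have := h (s.mapRange ι (map_zero ι)) (fun x => by simpa using map_mem_wt ι (hs x)) (by
    rw [Finsupp.sum_mapRange_index (by simp)]
    simp_rw [← map_smul]
    rw [← map_finsuppSum]
    exact map_mem_topPart ι hsum) x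
  rw [Finsupp.mapRange_apply] at this
  have h2 := map_mem_topPart r this
  rwa [← LinearMap.comp_apply, hr] at h2

theorem exists_lift_topPart (hZ : ∀ v : M, Z • v = 0)
    (htop : ∀ n : ℕ, 1 ≤ n → ∀ v ∈ wt M (hh0 + n), v = 0) {A : Submodule U M}
    (hA : topPart M hh0 k ≤ A) {v : M} (hv : v ∈ wt M (hh0 - k)) :
    ∃ T : Verma (hh0 - k) 0 →ₗ[U] M ⧸ A, T (hwVec _ 0) = A.mkQ v := by
  refine exists_verma_lift ?_ ?_ (map_mem_wt A.mkQ hv) ?_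
  · rw [← map_smul, Submodule.mkQ_apply, Submodule.Quotient.mk_eq_zero]
    exact hA (mem_topPart_of_mem_wt_add htop (n := 2) (by omega) (by
      simpa using E_smul_mem_wt hv))
  · rw [← map_smul, Submodule.mkQ_apply, Submodule.Quotient.mk_eq_zero]
    exact hA (mem_topPart_of_mem_wt_add htop (n := 1) le_rfl (by
      simpa using P_smul_mem_wt hv))
  · rw [← map_smul, hZ, map_zero]

theorem map_verma_expansion {μ : ℂ} {A : Submodule U M} {T : Verma μ 0 →ₗ[U] M ⧸ A} {v : M}
    (hT : T (hwVec μ 0) = A.mkQ v) (c : ℕ × ℕ →₀ ℂ) :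
    T (c.sum fun x r => r • (F ^ x.1 * Q ^ x.2) • hwVec μ 0) =
      A.mkQ ((c.mapRange (· • v) (zero_smul ℂ v)).sum fun x v => (F ^ x.1 * Q ^ x.2) • v) := by
  rw [Finsupp.sum_mapRange_index (fun _ => smul_zero _), map_finsuppSum, map_finsuppSum]
  refine Finsupp.sum_congr fun x _ => ?_
  rw [LinearMap.map_smul_of_tower, map_smul, hT, smul_comm_U, LinearMap.map_smul_of_tower,
    map_smul]

theorem exists_sub_sum_mem_topPart (hZ : ∀ v : M, Z • v = 0)
    (htop : ∀ n : ℕ, 1 ≤ n → ∀ v ∈ wt M (hh0 + n), v = 0) {t : Set M}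
    (ht : t ⊆ wt M (hh0 - k)) {w : M} (hw : w ∈ topPart M hh0 k ⊔ Submodule.span U t) :
    ∃ s : ℕ × ℕ →₀ M,
      (∀ x, s x ∈ wt M (hh0 - k) ∧ s x ∈ topPart M hh0 k ⊔ Submodule.span U t) ∧
      w - s.sum (fun x v => (F ^ x.1 * Q ^ x.2) • v) ∈ topPart M hh0 k := by
  obtain ⟨w1, hw1, w2, hw2, rfl⟩ := Submodule.mem_sup.1 hw
  suffices H : ∃ s : ℕ × ℕ →₀ M,
      (∀ x, s x ∈ wt M (hh0 - k) ∧ s x ∈ topPart M hh0 k ⊔ Submodule.span U t) ∧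
      w2 - s.sum (fun x v => (F ^ x.1 * Q ^ x.2) • v) ∈ topPart M hh0 k by
    obtain ⟨s, hs, h⟩ := H
    exact ⟨s, hs, by rw [add_sub_assoc]; exact add_mem hw1 h⟩
  clear hw
  induction hw2 using Submodule.closure_induction with
  | zero => exact ⟨0, fun x => ⟨zero_mem _, zero_mem _⟩, by simp⟩
  | add v w _ _ hv hw =>
    obtain ⟨s, hs, h⟩ := hv
    obtain ⟨s', hs', h'⟩ := hw
    refine ⟨s + s', fun x => ⟨add_mem (hs x).1 (hs' x).1, add_mem (hs x).2 (hs' x).2⟩, ?_⟩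
    rw [Finsupp.sum_add_index' (by simp) (by simp [smul_add]), add_sub_add_comm]
    exact add_mem h h'
  | smul_mem u v hv =>
    obtain ⟨T, hT⟩ := exists_lift_topPart hZ htop (le_refl (topPart M hh0 k)) (ht hv)
    obtain ⟨c, hc⟩ := exists_verma_expansion (u • hwVec (hh0 - k) 0)
    refine ⟨c.mapRange (· • v) (zero_smul ℂ v), fun x => ?_, ?_⟩
    · rw [Finsupp.mapRange_apply]
      exact ⟨Submodule.smul_mem _ _ (ht hv), Submodule.smul_of_tower_mem _ _
        (Submodule.mem_sup_right (Submodule.subset_span hv))⟩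
    · rw [← Submodule.Quotient.mk_eq_zero, ← Submodule.mkQ_apply, map_sub,
        ← map_verma_expansion hT, ← hc, map_smul, map_smul, hT, sub_self]

variable (hh0 i) in
/-- The subquotient `B / A` is a Verma module of highest weight `hh0 - j` with `j < i`. -/
def VermaStep (A B : Submodule U M) : Prop :=
  A ≤ B ∧ ∃ j < i, Nonempty (subQuot A B ≃ₗ[U] Verma (hh0 - j) 0)

theorem vermaStep_sup_span (hZ : ∀ v : M, Z • v = 0)
    (htop : ∀ n : ℕ, 1 ≤ n → ∀ v ∈ wt M (hh0 + n), v = 0) (hfree : FreeBelow M hh0 k)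
    (hk : k < i) {t : Set M} (ht : t ⊆ wt M (hh0 - k)) {v : M} (hv : v ∈ wt M (hh0 - k))
    (hvA : v ∉ topPart M hh0 k ⊔ Submodule.span U t) :
    VermaStep hh0 i (topPart M hh0 k ⊔ Submodule.span U t)
      (topPart M hh0 k ⊔ Submodule.span U (insert v t)) := by
  have hAB : topPart M hh0 k ⊔ Submodule.span U t ≤
      topPart M hh0 k ⊔ Submodule.span U (insert v t) :=
    sup_le_sup_left (Submodule.span_mono (Set.subset_insert v t)) _
  refine ⟨hAB, k, hk, ?_⟩
  have hB : topPart M hh0 k ⊔ Submodule.span U (insert v t) =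
      (topPart M hh0 k ⊔ Submodule.span U t) ⊔ Submodule.span U {v} := by
    rw [sup_assoc, ← Submodule.span_union, Set.union_singleton]
  have hrep := fun w hw => exists_sub_sum_mem_topPart (w := w) hZ htop ht hw
  obtain ⟨T, hT⟩ := exists_lift_topPart hZ htop
    (le_sup_left : topPart M hh0 k ≤ topPart M hh0 k ⊔ Submodule.span U t) hv
  generalize topPart M hh0 k ⊔ Submodule.span U (insert v t) = B at *
  have hA : topPart M hh0 k ≤ topPart M hh0 k ⊔ Submodule.span U t := le_sup_left
  generalize topPart M hh0 k ⊔ Submodule.span U t = A at *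
  have hinj : Function.Injective T := by
    rw [← LinearMap.ker_eq_bot, eq_bot_iff]
    intro w hw
    obtain ⟨c, rfl⟩ := exists_verma_expansion w
    rw [LinearMap.mem_ker, map_verma_expansion hT, Submodule.mkQ_apply,
      Submodule.Quotient.mk_eq_zero] at hw
    obtain ⟨s, hs, h⟩ := hrep _ hw
    have h0 : c = 0 := by
      ext x
      have := hfree (c.mapRange (· • v) (zero_smul ℂ v) - s)
        (fun x => sub_mem (Submodule.smul_mem _ _ hv) (hs x).1) (by
          rw [Finsupp.sum_sub_index (by simp [smul_sub])]
          exact h) x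
      have h2 := add_mem (hA this) (hs x).2
      rw [Finsupp.sub_apply, sub_add_cancel, Finsupp.mapRange_apply] at h2
      by_contra hc
      refine hvA ?_
      simpa [smul_smul, inv_mul_cancel₀ hc] using
        Submodule.smul_of_tower_mem A (c x)⁻¹ h2
    rw [h0, Finsupp.sum_zero_index]
    exact zero_mem _
  let f : B →ₗ[U] M ⧸ A := A.mkQ ∘ₗ B.subtype
  have hf : LinearMap.ker f = A.comap B.subtype := by
    rw [LinearMap.ker_comp, Submodule.ker_mkQ]
  have hr : LinearMap.range f = LinearMap.range T := by
    rw [LinearMap.range_comp, Submodule.range_subtype, hB, Submodule.map_sup,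
      Submodule.mkQ_map_self, bot_sup_eq, Submodule.map_span, Set.image_singleton, ← hT,
      LinearMap.range_eq_map, ← span_hwVec, Submodule.map_span, Set.image_singleton]
  exact ⟨(Submodule.quotEquivOfEq _ _ hf.symm).trans <| f.quotKerEquivRange.trans <|
    (LinearEquiv.ofEq _ _ hr).trans (LinearEquiv.ofInjective T hinj).symm⟩

theorem reflTransGen_topPart_succ (hZ : ∀ v : M, Z • v = 0)
    (htop : ∀ n : ℕ, 1 ≤ n → ∀ v ∈ wt M (hh0 + n), v = 0) (hfree : FreeBelow M hh0 k)
    (hk : k < i) [FiniteDimensional ℂ (wt M (hh0 - k))] :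
    Relation.ReflTransGen (VermaStep hh0 i) (topPart M hh0 k) (topPart M hh0 (k + 1)) := by
  classical
  obtain ⟨t, ht⟩ := (Submodule.fg_iff_finiteDimensional (wt M (hh0 - k))).2 inferInstance
  have htw : (t : Set M) ⊆ wt M (hh0 - k) := ht ▸ Submodule.subset_span
  have h1 : topPart M hh0 (k + 1) = topPart M hh0 k ⊔ Submodule.span U (t : Set M) := by
    rw [topPart_succ, ← ht, Submodule.span_span_of_tower]
  rw [h1]
  clear h1 ht
  induction t using Finset.induction_on with
  | empty => simpa using Relation.ReflTransGen.refl
  | insert v t _ ih =>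
    rw [Finset.coe_insert] at htw ⊢
    have hv := htw (Set.mem_insert v _)
    have ht := (Set.subset_insert v (t : Set M)).trans htw
    by_cases hvA : v ∈ topPart M hh0 k ⊔ Submodule.span U (t : Set M)
    · convert ih ht using 1
      refine le_antisymm (sup_le le_sup_left ?_)
        (sup_le_sup_left (Submodule.span_mono (Set.subset_insert v t)) _)
      rw [Submodule.span_insert]
      exact sup_le ((Submodule.span_singleton_le_iff_mem _ _).2 hvA) le_sup_right
    · exact (ih ht).tail (vermaStep_sup_span hZ htop hfree hk ht hv hvA)

omit [Module ℂ M] [IsScalarTower ℂ U M] in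
theorem exists_flag {K : Submodule U M} (h : Relation.ReflTransGen (VermaStep hh0 i) ⊥ K) :
    HasVermaFlagBelow hh0 i (M := ModuleCat.of U M) K := by
  induction h with
  | refl => exact ⟨0, fun _ => ⊥, monotone_const, rfl, rfl, fun k => k.elim0⟩
  | @tail A B _ hstep ih =>
    obtain ⟨n, Fl, hmono, h0, hlast, hsub⟩ := ih
    refine ⟨n + 1, Fin.snoc (α := fun _ => Submodule U M) Fl B, ?_, ?_, ?_, ?_⟩
    · rw [Fin.monotone_iff_le_succ]
      intro k
      induction k using Fin.lastCases with
      | last =>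
        rw [Fin.succ_last, Fin.snoc_last, Fin.snoc_castSucc, hlast]
        exact hstep.1
      | cast k =>
        rw [Fin.succ_castSucc, Fin.snoc_castSucc, Fin.snoc_castSucc]
        exact hmono k.castSucc_lt_succ.le
    · rw [← Fin.castSucc_zero, Fin.snoc_castSucc, h0]
    · exact Fin.snoc_last _ _
    · intro k
      induction k using Fin.lastCases with
      | last =>
        rw [Fin.succ_last, Fin.snoc_last, Fin.snoc_castSucc, hlast]
        exact hstep.2
      | cast k =>
        rw [Fin.succ_castSucc, Fin.snoc_castSucc, Fin.snoc_castSucc]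
        exact hsub k

theorem hasVermaFlagBelow_topPart (hZ : ∀ v : M, Z • v = 0)
    (htop : ∀ n : ℕ, 1 ≤ n → ∀ v ∈ wt M (hh0 + n), v = 0)
    (hfree : ∀ k < i, FreeBelow M hh0 k)
    (hfin : ∀ k < i, FiniteDimensional ℂ (wt M (hh0 - k))) :
    HasVermaFlagBelow hh0 i (M := ModuleCat.of U M) (topPart M hh0 i) := by
  refine exists_flag ?_
  have : ∀ k ≤ i, Relation.ReflTransGen (VermaStep hh0 i) ⊥ (topPart M hh0 k) := by
    intro k hk
    induction k with
    | zero => rw [topPart_zero]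
    | succ k ih =>
      have := hfin k hk
      exact (ih (by omega)).trans (reflTransGen_topPart_succ hZ htop (hfree k hk) hk)
  exact this i le_rfl

end
/-! ### Top weight spaces of the induced modules -/

section

variable {μ hh0 : ℂ} {i k : ℕ}

variable (i k) in
/-- The vectors of the truncation of `U(n₊)` of degree larger than `i - k`. -/
def baseTop : Submodule ℂ (Idx i → ℂ) where
  carrier := {n | ∀ y : Idx i, k + (2 * y.1.1 + y.1.2) ≤ i → n y = 0}
  add_mem' hn hm y hy := by rw [Pi.add_apply, hn y hy, hm y hy, add_zero]
  zero_mem' _ _ := rfl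
  smul_mem' r n hn y hy := by rw [Pi.smul_apply, hn y hy, smul_zero]

theorem baseH_mem_baseTop {n : Idx i → ℂ} (hn : n ∈ baseTop i k) :
    baseH μ i n ∈ baseTop i k := fun y hy => by
  simp [baseH, hn y hy]

theorem baseE_mem_baseTop {n : Idx i → ℂ} (hn : n ∈ baseTop i k) : baseE i n ∈ baseTop i k := by
  rintro ⟨⟨_ | c, d⟩, h⟩ hy
  · rfl
  · exact hn ⟨(c, d), by simp only at *; omega⟩ (by simp only at *; omega)

theorem baseP_mem_baseTop {n : Idx i → ℂ} (hn : n ∈ baseTop i k) : baseP i n ∈ baseTop i k := by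
  rintro ⟨⟨c, _ | d⟩, h⟩ hy
  · rfl
  · exact hn ⟨(c, d), by simp only at *; omega⟩ (by simp only at *; omega)

variable (μ i k) in
/-- The vectors of the induced module all of whose coefficients have degree larger than
`i - k`. -/
def coeffTop : Submodule ℂ (Univ μ i) where
  carrier := {w | ∀ x, coeff x w ∈ baseTop i k}
  add_mem' hv hw x := by rw [map_add]; exact add_mem (hv x) (hw x)
  zero_mem' x := by rw [map_zero]; exact zero_mem _
  smul_mem' r v hv x := by rw [map_smul]; exact Submodule.smul_mem _ _ (hv x)

theorem um_mem_coeffTop {a b : ℕ} {n : Idx i → ℂ} (hn : n ∈ baseTop i k) :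
    um μ a b n ∈ coeffTop μ i k := by
  intro x
  rw [coeff_um]
  split_ifs
  exacts [hn, zero_mem _]

theorem gen_smul_mem_coeffTop (g : Gen) {w : Univ μ i} (hw : w ∈ coeffTop μ i k) :
    gen g • w ∈ coeffTop μ i k := by
  obtain ⟨s, hs⟩ := sum_um_coeff w
  rw [hs, Finset.smul_sum]
  refine sum_mem fun x _ => ?_
  have hx := hw x
  generalize coeff x w = n at hx
  have hE := um_mem_coeffTop (μ := μ) (a := x.1) (b := x.2) (baseE_mem_baseTop hx)
  cases g
  · change E • _ ∈ _
    rw [E_smul_um]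
    exact add_mem (add_mem hE (Submodule.smul_mem _ _ (um_mem_coeffTop (baseP_mem_baseTop hx))))
      (Submodule.smul_mem _ _ (sub_mem (um_mem_coeffTop (baseH_mem_baseTop hx))
        (Submodule.smul_mem _ _ (um_mem_coeffTop hx))))
  · change H • _ ∈ _
    rw [H_smul_um]
    exact sub_mem (um_mem_coeffTop (baseH_mem_baseTop hx))
      (Submodule.smul_mem _ _ (um_mem_coeffTop hx))
  · change F • _ ∈ _
    rw [F_smul_um]
    exact um_mem_coeffTop hx
  · change P • _ ∈ _
    rw [P_smul_um]
    exact sub_mem (um_mem_coeffTop (baseP_mem_baseTop hx))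
      (Submodule.smul_mem _ _ (um_mem_coeffTop hx))
  · change Q • _ ∈ _
    rw [Q_smul_um]
    exact um_mem_coeffTop hx
  · change Z • _ ∈ _
    rw [Z_smul_univ]
    exact zero_mem _

theorem degree_eq {j : ℕ} {v : Univ (hh0 - i) i} (hv : v ∈ wt (Univ (hh0 - i) i) (hh0 - j))
    {x : ℕ × ℕ} {y : Idx i} (h : coeff x v y ≠ 0) :
    i + (2 * x.1 + x.2) = j + (2 * y.1.1 + y.1.2) := by
  have := eq_of_mem_wt hv h
  rify [← @Nat.cast_inj ℂ]
  push_cast at this ⊢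
  linear_combination this

theorem mem_topPart_univ {w : Univ (hh0 - i) i} :
    w ∈ topPart (Univ (hh0 - i) i) hh0 k ↔ w ∈ coeffTop (hh0 - i) i k := by
  constructor
  · intro h
    suffices topPart (Univ (hh0 - i) i) hh0 k ≤
      submoduleOfGen (coeffTop (hh0 - i) i k) fun g _ => gen_smul_mem_coeffTop g from this h
    refine Submodule.span_le.2 ?_
    rintro v ⟨j, hj, hv⟩ x y hy
    by_contra h
    have := degree_eq hv h
    omega
  · intro h
    have := Fintype.ofFinite (Idx i)
    obtain ⟨s, hs⟩ := sum_um_coeff w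
    rw [hs]
    refine sum_mem fun x _ => ?_
    rw [um_eq_sum]
    refine sum_mem fun y _ => ?_
    by_cases hy : k + (2 * y.1.1 + y.1.2) ≤ i
    · rw [h x y hy, zero_smul]
      exact zero_mem _
    · refine Submodule.smul_of_tower_mem _ _ (Submodule.smul_mem _ _
        (mem_topPart (j := i - (2 * y.1.1 + y.1.2)) (by omega) ?_))
      rw [Nat.cast_sub y.2, ← sub_add]
      exact EP_smul_mem_wt univGen_mem_wt _ _

theorem freeBelow_univ : FreeBelow (Univ (hh0 - i) i) hh0 k := by
  intro s hs hsum
  have ht : ∀ z, s z - um _ 0 0 (coeff (0, 0) (s z)) ∈ topPart (Univ (hh0 - i) i) hh0 k := by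
    intro z
    rw [mem_topPart_univ]
    intro x y hy
    rw [map_sub, coeff_um]
    split_ifs with hx
    · rw [← hx, sub_self]
      rfl
    · rw [sub_zero]
      by_contra h
      have := degree_eq (hs z) h
      exact hx (Prod.ext (by simp only; omega) (by simp only; omega))
  intro z
  by_cases hz : z ∈ s.support
  · have h1 : ∑ z ∈ s.support, um (hh0 - i) z.1 z.2 (coeff (0, 0) (s z)) ∈
        topPart (Univ (hh0 - i) i) hh0 k := by
      have h2 := sub_mem hsum (sum_mem fun z (_ : z ∈ s.support) =>
        Submodule.smul_mem _ (F ^ z.1 * Q ^ z.2) (ht z))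
      rw [Finsupp.sum, ← Finset.sum_sub_distrib] at h2
      simpa [smul_sub, FQ_smul_um] using h2
    rw [mem_topPart_univ] at h1
    have h3 := h1 z
    rw [map_sum, Finset.sum_eq_single z, coeff_um, if_pos rfl] at h3
    · have h4 := add_mem (ht z) (mem_topPart_univ.2 (um_mem_coeffTop (a := 0) (b := 0) h3))
      rwa [sub_add_cancel] at h4
    · intro z' _ hz'
      rw [coeff_um, if_neg hz']
    · exact fun h => absurd hz h
  · rw [Finsupp.notMem_support_iff.1 hz]
    exact zero_mem _

instance finiteDimensional_wt_univ (k : ℕ) :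
    FiniteDimensional ℂ (wt (Univ (hh0 - i) i) (hh0 - k)) := by
  have h : wt (Univ (hh0 - i) i) (hh0 - k) ≤ depth (hh0 - i) i k := by
    intro w hw x hx
    ext y
    by_contra h
    have := degree_eq hw h
    have := y.2
    omega
  exact Submodule.finiteDimensional_of_le h

theorem hasVermaFlagBelow_of_retract {N : Type} [AddCommGroup N] [Module U N] [Module ℂ N]
    [IsScalarTower ℂ U N] {ι : N →ₗ[U] Univ (hh0 - i) i} {r : Univ (hh0 - i) i →ₗ[U] N}
    (hr : r ∘ₗ ι = LinearMap.id) :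
    HasVermaFlagBelow hh0 i (M := ModuleCat.of U N) (topPart N hh0 i) := by
  have hr' : Function.LeftInverse r ι := fun x => LinearMap.congr_fun hr x
  obtain ⟨hZ, -, htop⟩ := inTrunc_data (inTrunc_of_surjective r hr'.surjective)
  refine hasVermaFlagBelow_topPart hZ htop (fun k _ => freeBelow_univ.retract hr) fun k _ => ?_
  let T : wt N (hh0 - k) →ₗ[ℂ] wt (Univ (hh0 - i) i) (hh0 - k) :=
    (ι.restrictScalars ℂ).restrict fun v hv => map_mem_wt ι hv
  exact FiniteDimensional.of_injective T fun v w h =>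
    Subtype.ext (hr'.injective (congrArg Subtype.val h))

/-- The kernel of the projection to the Verma module is generated by the higher weights. -/
theorem ker_eq_topPart_univ {ρ : Univ (hh0 - i) i →ₗ[U] Verma (hh0 - i) 0}
    (hρ : ρ (univGen _ i) = hwVec _ 0) :
    LinearMap.ker ρ = topPart (Univ (hh0 - i) i) hh0 i := by
  obtain ⟨hZ, -, htop⟩ := inTrunc_data (inTrunc_of_surjective (hh0 := hh0) (i := i)
    LinearMap.id Function.surjective_id)
  apply le_antisymm
  · obtain ⟨T, hT⟩ := exists_lift_topPart (hh0 := hh0) (k := i) hZ htop le_rfl univGen_mem_wt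
    have : T ∘ₗ ρ = (topPart (Univ (hh0 - i) i) hh0 i).mkQ :=
      hom_ext_univ (by rw [LinearMap.comp_apply, hρ, hT])
    rw [← Submodule.ker_mkQ (topPart (Univ (hh0 - i) i) hh0 i), ← this]
    exact LinearMap.ker_le_ker_comp _ _
  · refine Submodule.span_le.2 ?_
    rintro v ⟨j, hj, hv⟩
    obtain ⟨T, hT⟩ := exists_univ_to_verma (hh0 - i) 0
    rw [SetLike.mem_coe, LinearMap.mem_ker]
    have hin : InTrunc (hh0 - i) (ModuleCat.of U (Verma (hh0 - i) 0)) := by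
      have := inTrunc_of_surjective (hh0 := hh0 - i) (i := 0) (M := Verma (hh0 - i) 0)
      rw [Nat.cast_zero, sub_zero] at this
      exact this T (surjective_of_hwVec hT)
    refine (inTrunc_data hin).2.2 (i - j) (by omega) _ ?_
    rw [Nat.cast_sub hj.le, sub_add_sub_cancel]
    exact map_mem_wt ρ hv

end
/-! ### Indecomposable summands -/

section

theorem isUnit_or_isNilpotent_of_idempotents {A : Type*} [Ring A] [Algebra ℂ A]
    [FiniteDimensional ℂ A] (h : ∀ e : A, IsIdempotentElem e → e = 0 ∨ e = 1) (φ : A) :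
    IsUnit φ ∨ IsNilpotent φ := by
  open Polynomial in
  have hm : minpoly ℂ φ ≠ 0 := minpoly.ne_zero (Algebra.IsIntegral.isIntegral φ)
  obtain ⟨g, hg, hXg⟩ := exists_eq_pow_rootMultiplicity_mul_and_not_dvd (X * minpoly ℂ φ)
    (mul_ne_zero X_ne_zero hm) 0
  have hpos : 0 < rootMultiplicity 0 (X * minpoly ℂ φ) := by
    rw [rootMultiplicity_pos (mul_ne_zero X_ne_zero hm)]
    simp
  generalize rootMultiplicity 0 (X * minpoly ℂ φ) = k at hg hpos
  rw [map_zero, sub_zero] at hg hXg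
  obtain ⟨a, b, hab⟩ : IsCoprime (X ^ k) g :=
    (((irreducible_X (R := ℂ)).coprime_iff_not_dvd).2 hXg).pow_left
  have h0 : aeval φ (X ^ k * g) = 0 := by
    rw [← hg, map_mul, minpoly.aeval, mul_zero]
  have hidem : IsIdempotentElem (aeval φ (a * X ^ k)) := by
    rw [IsIdempotentElem, ← map_mul, ← sub_eq_zero, ← map_sub,
      show a * X ^ k * (a * X ^ k) - a * X ^ k = -(a * b) * (X ^ k * g) by
        linear_combination (a * X ^ k) * hab,
      map_mul, h0, mul_zero]
  rcases h _ hidem with he | he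
  · refine .inr ⟨k, ?_⟩
    have : (X ^ k : ℂ[X]) = X ^ k * (a * X ^ k) + b * (X ^ k * g) := by
      linear_combination -(X ^ k) * hab
    have := congrArg (aeval φ) this
    rwa [map_add, map_mul _ (X ^ k) (a * X ^ k), map_mul _ b, he, h0, mul_zero, mul_zero, add_zero,
      map_pow, aeval_X] at this
  · left
    obtain ⟨k, rfl⟩ : ∃ k', k = k' + 1 := ⟨k - 1, by omega⟩
    have h1 : φ * aeval φ (a * X ^ k) = 1 := by
      rw [← he, pow_succ, ← mul_assoc, mul_comm _ X, map_mul (aeval φ) X, aeval_X]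
    have h2 : aeval φ (a * X ^ k) * φ = 1 := by
      rw [← he, pow_succ, ← mul_assoc, map_mul (aeval φ) _ X, aeval_X]
    exact ⟨⟨φ, _, h1, h2⟩, rfl⟩

theorem Indec.eq_bot_or {N : Type} [AddCommGroup N] [Module U N] (h : Indec (ModuleCat.of U N))
    {A B : Submodule U N} (hAB : IsCompl A B) : A = ⊥ ∨ B = ⊥ := by
  by_contra! h'
  exact h.2 ⟨A, B, hAB, h'⟩

theorem Indec.eq_zero_or_one {N : Type} [AddCommGroup N] [Module U N]
    (h : Indec (ModuleCat.of U N)) (e : Module.End U N) (he : IsIdempotentElem e) :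
    e = 0 ∨ e = 1 := by
  refine (h.eq_bot_or (LinearMap.IsIdempotentElem.isCompl he)).imp LinearMap.range_eq_bot.1 fun hk => ?_
  have hinj := LinearMap.ker_eq_bot.1 hk
  ext v
  exact hinj (LinearMap.congr_fun he v)

/-- An indecomposable module with finite-dimensional endomorphism ring is isomorphic to any
indecomposable module which shares with it a projective cover property. -/
theorem nonempty_equiv_of_indec {N N' L : Type} [AddCommGroup N] [Module U N] [Module ℂ N]
    [IsScalarTower ℂ U N] [AddCommGroup N'] [Module U N'] [AddCommGroup L] [Module U L]
    [FiniteDimensional ℂ (Module.End U N)] (hN : Indec (ModuleCat.of U N))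
    (hN' : Indec (ModuleCat.of U N')) {π : N →ₗ[U] L} {π' : N' →ₗ[U] L} (hπ : π ≠ 0)
    {a : N →ₗ[U] N'} {b : N' →ₗ[U] N} (ha : π' ∘ₗ a = π) (hb : π ∘ₗ b = π') :
    Nonempty (N' ≃ₗ[U] N) := by
  have hba : ∀ n : ℕ, π ∘ₗ (b ∘ₗ a : Module.End U N) ^ n = π := by
    intro n
    induction n with
    | zero => rfl
    | succ n ih =>
      rw [pow_succ, Module.End.mul_eq_comp, ← LinearMap.comp_assoc, ih, ← LinearMap.comp_assoc,
        hb, ha]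
  rcases isUnit_or_isNilpotent_of_idempotents hN.eq_zero_or_one (b ∘ₗ a : Module.End U N) with
    hu | ⟨n, hn⟩
  · rw [Module.End.isUnit_iff] at hu
    have hcompl : IsCompl (LinearMap.range a) (LinearMap.ker b) := by
      constructor
      · rw [Submodule.disjoint_def]
        rintro _ ⟨v, rfl⟩ hv
        rw [hu.1 (a₁ := v) (a₂ := 0) (by rw [map_zero]; exact hv), map_zero]
      · rw [codisjoint_iff, eq_top_iff]
        intro v _
        obtain ⟨w, hw⟩ := hu.2 (b v)
        rw [← add_sub_cancel (a w) v]
        refine add_mem (Submodule.mem_sup_left ⟨w, rfl⟩) (Submodule.mem_sup_right ?_)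
        rw [LinearMap.mem_ker, map_sub, sub_eq_zero]
        exact hw.symm
    rcases hN'.eq_bot_or hcompl with h | h
    · rw [LinearMap.range_eq_bot] at h
      rw [h, LinearMap.comp_zero] at ha
      exact absurd ha.symm hπ
    · exact ⟨LinearEquiv.ofBijective b ⟨LinearMap.ker_eq_bot.1 h, (show Function.Surjective (b ∘ a) from hu.2).of_comp⟩⟩
  · have := hba n
    rw [hn, LinearMap.comp_zero] at this
    exact absurd this.symm hπ

variable {hh0 : ℂ} {i : ℕ}

theorem finiteDimensional_end {N : Type} [AddCommGroup N] [Module U N] [Module ℂ N]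
    [IsScalarTower ℂ U N] {ι : N →ₗ[U] Univ (hh0 - i) i} {r : Univ (hh0 - i) i →ₗ[U] N}
    (hr : r ∘ₗ ι = LinearMap.id) : FiniteDimensional ℂ (Module.End U N) := by
  have hr' : Function.LeftInverse r ι := fun x => LinearMap.congr_fun hr x
  let T : Module.End U N →ₗ[ℂ] wt (Univ (hh0 - i) i) (hh0 - i) :=
    { toFun := fun φ => ⟨ι (φ (r (univGen _ i))),
        map_mem_wt ι (map_mem_wt φ (map_mem_wt r univGen_mem_wt))⟩
      map_add' := fun φ ψ => Subtype.ext (by simp)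
      map_smul' := fun c φ => Subtype.ext (by simp [LinearMap.map_smul_of_tower]) }
  refine FiniteDimensional.of_injective T fun φ ψ h => ?_
  have h1 : φ ∘ₗ r = ψ ∘ₗ r := hom_ext_univ (hr'.injective (congrArg Subtype.val h))
  exact (LinearMap.cancel_right hr'.surjective).1 h1

theorem finrank_map_lt {e e₁ e₂ : Module.End U (Univ (hh0 - i) i)} (he : e = e₁ + e₂)
    (h1 : IsIdempotentElem e₁) (h2 : IsIdempotentElem e₂)
    (h21 : e₂ * e₁ = 0) (h0 : e₂ ≠ 0) :
    Module.finrank ℂ ((wt (Univ (hh0 - i) i) (hh0 - i)).map (e₁.restrictScalars ℂ)) <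
      Module.finrank ℂ ((wt (Univ (hh0 - i) i) (hh0 - i)).map (e.restrictScalars ℂ)) := by
  have hee : e * e₁ = e₁ := by rw [he, add_mul, h1.eq, h21, add_zero]
  have h2e : e₂ * e = e₂ := by rw [he, mul_add, h21, h2.eq, zero_add]
  refine Submodule.finrank_lt_finrank_of_lt (lt_of_le_of_ne ?_ fun h => h0 ?_)
  · rintro _ ⟨w, hw, rfl⟩
    exact ⟨e₁ w, map_mem_wt e₁ hw, LinearMap.congr_fun hee w⟩
  · obtain ⟨w, -, hw⟩ : e.restrictScalars ℂ (univGen _ i) ∈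
        (wt (Univ (hh0 - i) i) (hh0 - i)).map (e₁.restrictScalars ℂ) :=
      h ▸ Submodule.mem_map_of_mem univGen_mem_wt
    refine hom_ext_univ ?_
    rw [← h2e]
    have := congrArg e₂ hw
    exact this.symm.trans (LinearMap.congr_fun h21 w)

theorem exists_primitive (ρ : Univ (hh0 - i) i →ₗ[U] Verma (hh0 - i) 0)
    (hρ : Function.Surjective ρ) :
    ∃ e : Module.End U (Univ (hh0 - i) i), IsIdempotentElem e ∧
      LinearMap.range (ρ ∘ₗ e) = ⊤ ∧
      ∀ e₁ e₂ : Module.End U (Univ (hh0 - i) i), IsIdempotentElem e₁ → IsIdempotentElem e₂ →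
        e₁ * e₂ = 0 → e₂ * e₁ = 0 → e = e₁ + e₂ → e₁ = 0 ∨ e₂ = 0 := by
  let S : Set (Module.End U (Univ (hh0 - i) i)) :=
    {e | IsIdempotentElem e ∧ LinearMap.range (ρ ∘ₗ e) = ⊤}
  let d (e : Module.End U (Univ (hh0 - i) i)) : ℕ :=
    Module.finrank ℂ ((wt (Univ (hh0 - i) i) (hh0 - i)).map (e.restrictScalars ℂ))
  have hS : S.Nonempty := ⟨1, IsIdempotentElem.one, LinearMap.range_eq_top.2 hρ⟩
  obtain ⟨e, ⟨he, hr⟩, hmin⟩ := (measure d).wf.has_min S hS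
  refine ⟨e, he, hr, fun e₁ e₂ h1 h2 h12 h21 hsum => ?_⟩
  have hsup : LinearMap.range (ρ ∘ₗ e₁) ⊔ LinearMap.range (ρ ∘ₗ e₂) = ⊤ := by
    rw [eq_top_iff, ← hr]
    rintro _ ⟨w, rfl⟩
    rw [hsum, LinearMap.comp_add]
    exact add_mem (Submodule.mem_sup_left ⟨w, rfl⟩) (Submodule.mem_sup_right ⟨w, rfl⟩)
  rcases sup_eq_top hsup with h | h
  · right
    by_contra h0
    exact hmin e₁ ⟨h1, h⟩ (finrank_map_lt hsum h1 h2 h21 h0)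
  · left
    by_contra h0
    exact hmin e₂ ⟨h2, h⟩ (finrank_map_lt (hsum.trans (add_comm _ _)) h2 h1 h12 h0)

/-- The Verma module of highest weight `hh0 - i` is a quotient of an indecomposable direct
summand of the induced module. -/
theorem exists_indec_retract (ρ : Univ (hh0 - i) i →ₗ[U] Verma (hh0 - i) 0)
    (hρ : Function.Surjective ρ) :
    ∃ (N : Submodule U (Univ (hh0 - i) i)) (r : Univ (hh0 - i) i →ₗ[U] N),
      r ∘ₗ N.subtype = LinearMap.id ∧ Function.Surjective (ρ ∘ₗ N.subtype) ∧
      Indec (ModuleCat.of U N) := by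
  obtain ⟨e, he, hr, hprim⟩ := exists_primitive ρ hρ
  have hre : e.rangeRestrict ∘ₗ (LinearMap.range e).subtype = LinearMap.id := by
    ext ⟨_, w, rfl⟩
    exact LinearMap.congr_fun he w
  have hsurj : Function.Surjective (ρ ∘ₗ (LinearMap.range e).subtype) := by
    intro v
    obtain ⟨w, hw⟩ := LinearMap.range_eq_top.1 hr v
    exact ⟨⟨e w, w, rfl⟩, hw⟩
  refine ⟨LinearMap.range e, e.rangeRestrict, hre, hsurj, ?_, ?_⟩
  · obtain ⟨v, hv⟩ := hsurj (hwVec _ 0)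
    exact nontrivial_of_ne v 0 fun h => hwVec_ne_zero (by rw [← hv, h, map_zero])
  · rintro ⟨A, B, hAB, hA, hB⟩
    change Submodule U (LinearMap.range e) at A B
    let f (p : Module.End U (LinearMap.range e)) : Module.End U (Univ (hh0 - i) i) :=
      (LinearMap.range e).subtype ∘ₗ p ∘ₗ e.rangeRestrict
    have hmul (p q) : f p * f q = f (p * q) := by
      ext w
      have := LinearMap.congr_fun hre (q (e.rangeRestrict w))
      exact congrArg (fun x => ((p x : LinearMap.range e) : Univ (hh0 - i) i)) this
    have hzero : f 0 = 0 := rfl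
    have hf {p} (hp : f p = 0) : p = 0 := by
      ext ⟨_, w, rfl⟩
      exact LinearMap.congr_fun hp w
    have h12 : A.projection B hAB * B.projection A hAB.symm = 0 := by
      ext w
      exact congrArg Subtype.val ((Submodule.projection_apply_eq_zero_iff hAB).2
        (Submodule.projection_apply_mem hAB.symm w))
    have h21 : B.projection A hAB.symm * A.projection B hAB = 0 := by
      ext w
      exact congrArg Subtype.val ((Submodule.projection_apply_eq_zero_iff hAB.symm).2
        (Submodule.projection_apply_mem hAB w))
    rcases hprim (f (A.projection B hAB)) (f (B.projection A hAB.symm))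
      (by rw [IsIdempotentElem, hmul, (Submodule.isIdempotentElem_projection hAB).eq])
      (by rw [IsIdempotentElem, hmul, (Submodule.isIdempotentElem_projection hAB.symm).eq])
      (by rw [hmul, h12, hzero]) (by rw [hmul, h21, hzero])
      (by
        ext w
        exact congrArg Subtype.val
          (Submodule.projection_add_projection_eq_self hAB (e.rangeRestrict w)).symm) with h | h
    · rw [← Submodule.range_projection hAB, hf h, LinearMap.range_zero] at hA
      exact hA rfl
    · rw [← Submodule.range_projection hAB.symm, hf h, LinearMap.range_zero] at hB
      exact hB rfl

theorem inTrunc_simpleHW : InTrunc hh0 (ModuleCat.of U (SimpleHW (hh0 - i) 0)) := by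
  obtain ⟨ρ, hρ⟩ := exists_univ_to_verma (hh0 - i) i
  exact inTrunc_of_surjective ((vermaRad (hh0 - i) 0).mkQ ∘ₗ ρ)
    ((Submodule.mkQ_surjective _).comp (surjective_of_hwVec hρ))

end
/-- Proposition 12 of the paper: let `ξ ∈ 𝔥*/ℤR` have zero
central charge, `λ ∈ ξ` (with `λ(h) = hh0`) and `i ∈ ℤ≥0`.  Then in the
truncated category `O[ξ, λ]` the simple module `L(λ - i·h✓)` is a quotient of a
unique (up to isomorphism) indecomposable projective object
`P^{(λ)}(λ - i·h✓)`; moreover there is a surjection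
`P^{(λ)}(λ - i·h✓) ↠ Δ(λ - i·h✓)` whose kernel has a Verma flag, in which the
only occurring subquotients are Verma modules `Δ(λ - j·h✓)` with `j < i`. -/
theorem truncated_category_has_projectives (hh0 : ℂ) (i : ℕ) :
    ∃ Pm : ModuleCat.{0} U,
      InTrunc hh0 Pm ∧ ProjInTrunc hh0 Pm ∧ Indec Pm ∧
      (∃ π : (Pm : Type) →ₗ[U] SimpleHW (hh0 - i) 0, Function.Surjective π) ∧
      (∀ Pm' : ModuleCat.{0} U,
        InTrunc hh0 Pm' → ProjInTrunc hh0 Pm' → Indec Pm' →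
        (∃ π : (Pm' : Type) →ₗ[U] SimpleHW (hh0 - i) 0, Function.Surjective π) →
        Nonempty ((Pm' : Type) ≃ₗ[U] (Pm : Type))) ∧
      (∃ ρ : (Pm : Type) →ₗ[U] Verma (hh0 - i) 0, Function.Surjective ρ ∧
        HasVermaFlagBelow hh0 i (LinearMap.ker ρ)) := by
  obtain ⟨ρ, hρ⟩ := exists_univ_to_verma (hh0 - i) i
  obtain ⟨N, r, hr, hsurj, hindec⟩ := exists_indec_retract ρ (surjective_of_hwVec hρ)
  have hin : InTrunc hh0 (ModuleCat.of U N) :=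
    inTrunc_of_surjective r fun x => ⟨x, LinearMap.congr_fun hr x⟩
  have hproj : ProjInTrunc hh0 (ModuleCat.of U N) := (projInTrunc_univ hh0 i).retract _ r hr
  have hfin : FiniteDimensional ℂ (Module.End U N) := finiteDimensional_end hr
  let π : N →ₗ[U] SimpleHW (hh0 - i) 0 := (vermaRad (hh0 - i) 0).mkQ ∘ₗ ρ ∘ₗ N.subtype
  have hπ : Function.Surjective π := (Submodule.mkQ_surjective _).comp hsurj
  have hπ0 : π ≠ 0 := by
    intro h
    refine vermaRad_ne_top (μ := hh0 - i) (eq_top_iff.2 fun v _ => ?_)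
    obtain ⟨w, hw⟩ := hπ ((vermaRad (hh0 - i) 0).mkQ v)
    rw [h] at hw
    exact (Submodule.Quotient.mk_eq_zero _).1 hw.symm
  have hker : LinearMap.ker (ρ ∘ₗ N.subtype) = topPart N hh0 i := by
    ext v
    rw [LinearMap.ker_comp, ker_eq_topPart_univ hρ, Submodule.mem_comap]
    refine ⟨fun h => ?_, fun h => map_mem_topPart _ h⟩
    have h2 := map_mem_topPart r h
    rwa [← LinearMap.comp_apply, hr] at h2
  refine ⟨ModuleCat.of U N, hin, hproj, hindec, ⟨π, hπ⟩, ?_, ρ ∘ₗ N.subtype, hsurj, ?_⟩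
  · rintro N' hin' hproj' hindec' ⟨π', hπ'⟩
    obtain ⟨a, ha⟩ := hproj N' _ hin' inTrunc_simpleHW π' hπ' π
    obtain ⟨b, hb⟩ := hproj' (ModuleCat.of U N) _ hin inTrunc_simpleHW π hπ π'
    exact nonempty_equiv_of_indec hindec hindec' hπ0 ha hb
  · rw [hker]
    exact hasVermaFlagBelow_of_retract hr

end

end Schrodinger
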